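/- arXiv:math/9401213 — 2 statements merged into one kernel-verified Lean document; each statement's English description precedes it below -/
import Mathlib

section
/- Let T be a universal theory in a first-order language L that is κ-unique for some uncountable cardinal κ. Let L' ⊇ L be an expansion of L and M' an L'-structure such that L' has built-in Skolem functions for M' and the L-reduct M of M' is a model of T. Suppose U ⊆ M' carries a linear order ≤ making ⟨U,≤⟩ a dense linear order without endpoints of cardinality κ, U generates M' as an L'-structure, and U is a set of order-indiscernibles in M' with respect to all L'-formulas. Then for every countable set H of L'-terms there is a countable set K of L'-terms with H ⊆ K such that the L-structure Sg^M(K*U), where K*U = U ∪ { t^{M'}(ū) : t ∈ K, ū a tuple from U }, is an elementary substructure of M. -/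
open FirstOrder Language Cardinal

universe u

/-- `X` generates the `L`-structure `M`: the substructure generated by `X` is all of `M`. -/
def Generates (L : FirstOrder.Language.{u, u}) (M : Type u) [L.Structure M] (X : Set M) : Prop :=
  Substructure.closure L X = ⊤

/-- `M` is `μ`-generated: it is generated by a set of cardinality `μ`. -/
def IsGenerated (L : FirstOrder.Language.{u, u}) (M : Type u) [L.Structure M]
    (μ : Cardinal.{u}) : Prop :=
  ∃ X : Set M, #X = μ ∧ Generates L M X

/-- `M` is strictly `μ`-generated: it is `μ`-generated but not `ν`-generated for any `ν < μ`. -/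
def StrictlyGenerated (L : FirstOrder.Language.{u, u}) (M : Type u) [L.Structure M]
    (μ : Cardinal.{u}) : Prop :=
  IsGenerated L M μ ∧ ∀ ν < μ, ¬ IsGenerated L M ν

/-- A theory `T` is `κ`-unique: it has a strictly `κ`-generated model, and any two strictly
`κ`-generated models of `T` are isomorphic. -/
def KUnique {L : FirstOrder.Language.{u, u}} (T : L.Theory) (κ : Cardinal.{u}) : Prop :=
  (∃ (M : Type u) (_ : L.Structure M), M ⊨ T ∧ StrictlyGenerated L M κ) ∧
  (∀ (M N : Type u) (_ : L.Structure M) (_ : L.Structure N),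
    M ⊨ T → N ⊨ T → StrictlyGenerated L M κ → StrictlyGenerated L N κ →
      Nonempty (M ≃[L] N))

/-- A sentence is universal if it is of the form `∀ x₁ … ∀ xₙ, φ` with `φ` quantifier-free. -/
def IsUniversalSentence {L : FirstOrder.Language.{u, u}} (φ : L.Sentence) : Prop :=
  ∃ (n : ℕ) (ψ : L.BoundedFormula Empty n), ψ.IsQF ∧ φ = ψ.alls

/-- A theory is universal if every sentence of it is universal. -/
def IsUniversalTheory {L : FirstOrder.Language.{u, u}} (T : L.Theory) : Prop :=
  ∀ φ ∈ T, IsUniversalSentence φ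


/-- `K*V`: the set `V` together with all values of terms from `K` at tuples from `V`. -/
def KStarSet {L' : FirstOrder.Language.{u, u}} {M : Type u} [L'.Structure M]
    (K : Set (Σ n, L'.Term (Fin n))) (V : Set M) : Set M :=
  V ∪ {x | ∃ t ∈ K, ∃ v : Fin t.1 → ↥V, x = t.2.realize fun i => (v i : M)}

/-- Two tuples have the same order pattern. -/
def SameOrd {ι α β : Type*} [LinearOrder α] [LinearOrder β] (a : ι → α) (b : ι → β) : Prop :=
  ∀ i j, cmp (a i) (a j) = cmp (b i) (b j)

theorem SameOrd.symm {ι α β : Type*} [LinearOrder α] [LinearOrder β] {a : ι → α} {b : ι → β}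
    (h : SameOrd a b) : SameOrd b a := fun i j => (h i j).symm

/-- A set which is a nonempty dense order without endpoints in the induced order. -/
structure IsDLO {α : Type*} [LinearOrder α] (V : Set α) : Prop where
  nonempty : V.Nonempty
  exists_lt : ∀ x ∈ V, ∃ y ∈ V, y < x
  exists_gt : ∀ x ∈ V, ∃ y ∈ V, x < y
  exists_between : ∀ x ∈ V, ∀ y ∈ V, x < y → ∃ z ∈ V, x < z ∧ z < y

theorem IsDLO.univ {α : Type*} [LinearOrder α] [Nonempty α] [DenselyOrdered α] [NoMinOrder α]
    [NoMaxOrder α] : IsDLO (Set.univ : Set α) where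
  nonempty := Set.univ_nonempty
  exists_lt x _ := by simpa using NoMinOrder.exists_lt x
  exists_gt x _ := by simpa using NoMaxOrder.exists_gt x
  exists_between x _ y _ h := by simpa using _root_.exists_between h

/-- Finite partial order isomorphisms into a dense order without endpoints can be extended. -/
theorem SameOrd.exists_extend {ι ι₂ : Type} [Finite ι] [Finite ι₂] {α : Type*} [LinearOrder α]
    {V : Set α} (hV : IsDLO V) {a a' : ι → α} (ha : ∀ i, a i ∈ V) (h : SameOrd a a')
    (c' : ι₂ → α) :
    ∃ c : ι₂ → α, (∀ i, c i ∈ V) ∧ SameOrd (Sum.elim a c) (Sum.elim a' c') := by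
  classical
  have := Fintype.ofFinite ι
  have := Fintype.ofFinite ι₂
  have : Nonempty V := hV.nonempty.to_subtype
  have : NoMinOrder V := ⟨fun x => by
    obtain ⟨y, hy, h⟩ := hV.exists_lt x x.2
    exact ⟨⟨y, hy⟩, h⟩⟩
  have : NoMaxOrder V := ⟨fun x => by
    obtain ⟨y, hy, h⟩ := hV.exists_gt x x.2
    exact ⟨⟨y, hy⟩, h⟩⟩
  have : DenselyOrdered V := ⟨fun x y hxy => by
    obtain ⟨z, hz, h⟩ := hV.exists_between x x.2 y y.2 hxy
    exact ⟨⟨z, hz⟩, h⟩⟩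
  let P₀ : Order.PartialIso V α := ⟨Finset.univ.image fun i => (⟨a i, ha i⟩, a' i), by
    intro p hp q hq
    simp only [Finset.mem_image, Finset.mem_univ, true_and] at hp hq
    obtain ⟨i, rfl⟩ := hp
    obtain ⟨j, rfl⟩ := hq
    exact h i j⟩
  have key : ∀ G : Finset α, ∃ P : Order.PartialIso V α, P₀ ≤ P ∧
      ∀ g ∈ G, ∃ x : V, (x, g) ∈ P.val := by
    intro G
    induction G using Finset.induction_on with
    | empty => exact ⟨P₀, le_refl _, by simp⟩
    | insert g G _ ih =>
      obtain ⟨P, hP, hG⟩ := ih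
      obtain ⟨Q, ⟨x, hx⟩, hPQ⟩ := (Order.PartialIso.definedAtRight (V : Type _) g).isCofinal P
      refine ⟨Q, hP.trans hPQ, fun g' hg' => ?_⟩
      rcases Finset.mem_insert.1 hg' with rfl | hg'
      · exact ⟨x, hx⟩
      · obtain ⟨y, hy⟩ := hG g' hg'
        exact ⟨y, hPQ hy⟩
  obtain ⟨P, hP, hc⟩ := key (Finset.univ.image c')
  choose c hc using fun i => hc (c' i) (Finset.mem_image_of_mem _ (Finset.mem_univ i))
  have ha' : ∀ i, ((⟨a i, ha i⟩ : V), a' i) ∈ P.val := fun i =>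
    hP (Finset.mem_image_of_mem (fun i => ((⟨a i, ha i⟩ : V), a' i)) (Finset.mem_univ i))
  refine ⟨fun i => c i, fun i => (c i).2, ?_⟩
  rintro (i | i) (j | j)
  · exact P.2 _ (ha' i) _ (ha' j)
  · exact P.2 _ (ha' i) _ (hc j)
  · exact P.2 _ (hc i) _ (ha' j)
  · exact P.2 _ (hc i) _ (hc j)

/-- Indiscernibles satisfy the same formulas under assignments with the same order pattern. -/
theorem SameOrd.realize_iff {L' : FirstOrder.Language.{u, u}} {M : Type u} [L'.Structure M]
    {U : Set M} [LinearOrder U]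
    (hInd : ∀ (n : ℕ) (ψ : L'.Formula (Fin n)) (a b : Fin n → U),
      StrictMono a → StrictMono b →
      (ψ.Realize (fun i => (a i : M)) ↔ ψ.Realize fun i => (b i : M)))
    {ι : Type} [Finite ι] (ψ : L'.Formula ι) {a b : ι → U} (h : SameOrd a b) :
    ψ.Realize (fun i => (a i : M)) ↔ ψ.Realize fun i => (b i : M) := by
  classical
  have := Fintype.ofFinite ι
  let S : Finset U := Finset.univ.image a
  let e := S.orderIsoOfFin rfl
  let g : ι → Fin S.card := fun i => e.symm ⟨a i, Finset.mem_image_of_mem _ (Finset.mem_univ i)⟩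
  have hg : ∀ i, (e (g i) : U) = a i := fun i => by simp [g]
  have hex : ∀ k, ∃ i, a i = e k := fun k => by
    obtain ⟨i, _, hi⟩ := Finset.mem_image.1 (e k).2
    exact ⟨i, hi⟩
  choose r hr using hex
  have hb : StrictMono fun k => b (r k) := fun k l hkl => by
    have : a (r k) < a (r l) := by rw [hr, hr]; exact e.strictMono hkl
    rw [← cmp_eq_lt_iff] at this ⊢
    rw [← h]; exact this
  have ha : StrictMono fun k => (e k : U) := fun k l hkl => e.strictMono hkl
  have := hInd _ (ψ.relabel g) _ _ ha hb
  simp only [Formula.realize_relabel] at this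
  have hbg : ∀ i, b (r (g i)) = b i := fun i => by
    have := h (r (g i)) i
    rw [hr, hg, cmp_self_eq_eq] at this
    exact cmp_eq_eq_iff _ _ |>.1 this.symm
  convert this using 2
  · funext i; simp [hg]
  · funext i; simp [hbg]

section Sat

variable {L : FirstOrder.Language.{u, u}} {M : Type u} [L.Structure M]

/-- Satisfaction of a formula with quantifiers relativized to a set `S`. -/
def SatIn (S : Set M) {β : Type} : ∀ {n : ℕ}, L.BoundedFormula β n → (β → M) → (Fin n → M) → Prop
  | _, .falsum, _, _ => False
  | _, .equal t₁ t₂, v, xs => t₁.realize (Sum.elim v xs) = t₂.realize (Sum.elim v xs)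
  | _, .rel R ts, v, xs => Structure.RelMap R fun i => (ts i).realize (Sum.elim v xs)
  | _, .imp φ ψ, v, xs => SatIn S φ v xs → SatIn S ψ v xs
  | _, .all φ, v, xs => ∀ x ∈ S, SatIn S φ v (Fin.snoc xs x)

/-- The quantifier depth of a formula. -/
def qdepth {β : Type} : ∀ {n : ℕ}, L.BoundedFormula β n → ℕ
  | _, .falsum => 0
  | _, .equal _ _ => 0
  | _, .rel _ _ => 0
  | _, .imp φ ψ => max (qdepth φ) (qdepth ψ)
  | _, .all φ => qdepth φ + 1

theorem satIn_univ {β : Type} {n : ℕ} (φ : L.BoundedFormula β n) (v : β → M) (xs : Fin n → M) :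
    SatIn Set.univ φ v xs ↔ φ.Realize v xs := by
  induction φ with
  | falsum => rfl
  | equal => rfl
  | rel => rfl
  | imp φ ψ ih₁ ih₂ => simp [SatIn, ih₁, ih₂]
  | all φ ih => simp [SatIn, ih]

theorem satIn_coe {β : Type} {n : ℕ} (S : L.Substructure M) (φ : L.BoundedFormula β n)
    (v : β → S) (xs : Fin n → S) :
    SatIn (S : Set M) φ (fun i => v i) (fun i => xs i) ↔ φ.Realize v xs := by
  have hs : ∀ {k} (xs : Fin k → S) (t : L.Term (β ⊕ Fin k)),
      t.realize (Sum.elim (fun i => (v i : M)) (fun i => (xs i : M))) =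
        (t.realize (Sum.elim v xs) : S) := fun xs t => by
    rw [← Substructure.coe_subtype, ← HomClass.realize_term]
    congr 1
    ext (i | i) <;> rfl
  induction φ with
  | falsum => rfl
  | equal => simp only [SatIn, BoundedFormula.Realize, hs, Subtype.coe_inj]
  | rel => simp only [SatIn, BoundedFormula.Realize, hs]; rfl
  | imp φ ψ ih₁ ih₂ => simp [SatIn, ih₁, ih₂]
  | all φ ih =>
    simp only [SatIn, BoundedFormula.realize_all]
    have : ∀ x : S, (Fin.snoc (fun i => (xs i : M)) (x : M) : Fin _ → M) =
        fun i => ((Fin.snoc xs x : Fin _ → S) i : M) := fun x => by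
      funext i
      refine Fin.lastCases ?_ (fun i => ?_) i <;> simp
    constructor
    · intro h x
      refine (ih _).1 ?_
      rw [← this]
      exact h x x.2
    · intro h x hx
      rw [this ⟨x, hx⟩]
      exact (ih _).2 (h _)

/-- An isomorphism of substructures preserves satisfaction relativized to corresponding sets. -/
theorem satIn_equiv {β : Type} {n : ℕ} {A B : L.Substructure M} (f : A ≃[L] B) {S S' : Set M}
    (hS : S ⊆ A) (hS' : S' ⊆ B) (hf : ∀ x : A, (x : M) ∈ S ↔ (f x : M) ∈ S')
    (φ : L.BoundedFormula β n) (v : β → A) (xs : Fin n → A) :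
    SatIn S φ (fun i => v i) (fun i => xs i) ↔
      SatIn S' φ (fun i => f (v i)) (fun i => f (xs i)) := by
  have hA : ∀ {k} (xs : Fin k → A) (t : L.Term (β ⊕ Fin k)),
      t.realize (Sum.elim (fun i => (v i : M)) (fun i => (xs i : M))) =
        (t.realize (Sum.elim v xs) : A) := fun xs t => by
    rw [← Substructure.coe_subtype, ← HomClass.realize_term]
    congr 1
    ext (i | i) <;> rfl
  have hB : ∀ {k} (xs : Fin k → A) (t : L.Term (β ⊕ Fin k)),
      t.realize (Sum.elim (fun i => (f (v i) : M)) (fun i => (f (xs i) : M))) =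
        (f (t.realize (Sum.elim v xs)) : M) := fun xs t => by
    rw [← HomClass.realize_term, ← Substructure.coe_subtype, ← HomClass.realize_term]
    congr 1
    ext (i | i) <;> rfl
  induction φ with
  | falsum => rfl
  | equal => simp only [SatIn, hA, hB, Subtype.coe_inj, EmbeddingLike.apply_eq_iff_eq]
  | rel R ts =>
    simp only [SatIn, hA, hB]
    exact (StrongHomClass.map_rel f R fun i => (ts i).realize (Sum.elim v xs)).symm
  | imp φ ψ ih₁ ih₂ => simp [SatIn, ih₁, ih₂]
  | all φ ih =>
    simp only [SatIn]
    have hx : ∀ x : A, (Fin.snoc (fun i => (xs i : M)) (x : M) : Fin _ → M) =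
        fun i => ((Fin.snoc xs x : Fin _ → A) i : M) := fun x => by
      funext i
      refine Fin.lastCases ?_ (fun i => ?_) i <;> simp
    have hfx : ∀ x : A, (Fin.snoc (fun i => (f (xs i) : M)) (f x : M) : Fin _ → M) =
        fun i => (f ((Fin.snoc xs x : Fin _ → A) i) : M) := fun x => by
      funext i
      refine Fin.lastCases ?_ (fun i => ?_) i <;> simp
    constructor
    · intro h y hy
      obtain ⟨x, hxy⟩ := f.surjective ⟨y, hS' hy⟩
      have hfy : (f x : M) = y := by rw [hxy]
      rw [← hfy, hfx]
      refine (ih _).1 ?_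
      rw [← hx]
      exact h x ((hf x).2 (hfy ▸ hy))
    · intro h x hxS
      lift x to A using hS hxS
      rw [hx]
      refine (ih _).2 ?_
      rw [← hfx]
      exact h _ ((hf x).1 hxS)

end Sat

section Hull

variable {L L' : FirstOrder.Language.{u, u}} {M : Type u} [L.Structure M] [L'.Structure M]
  {U : Set M}

variable (L) in
/-- The `L`-substructure generated by `K*V`, for a subset `V` of `U`. -/
abbrev hull (K : Set (Σ n, L'.Term (Fin n))) (V : Set U) : L.Substructure M :=
  Substructure.closure L (KStarSet K (Subtype.val '' V))

/-- Names for the members of `K*V`, where the elements of `V` are named by `ι`. -/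
abbrev GenName (K : Set (Σ n, L'.Term (Fin n))) (ι : Type) : Type u :=
  ι ⊕ Σ t : K, Fin t.1.1 → ι

/-- The value of a name of a member of `K*V`. -/
def genValue (K : Set (Σ n, L'.Term (Fin n))) {ι : Type} (a : ι → U) : GenName K ι → M
  | .inl i => a i
  | .inr ⟨t, p⟩ => t.1.2.realize fun j => (a (p j) : M)

/-- The value of an `L`-term in names of members of `K*V`. -/
def hullValue (K : Set (Σ n, L'.Term (Fin n))) {ι : Type} (a : ι → U) (s : L.Term (GenName K ι)) :
    M :=
  s.realize (genValue K a)

theorem mem_kStarSet_image {K : Set (Σ n, L'.Term (Fin n))} {V : Set U} {x : M} :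
    x ∈ KStarSet K (Subtype.val '' V) ↔ (∃ u ∈ V, (u : M) = x) ∨
      ∃ t ∈ K, ∃ a : Fin t.1 → U, (∀ i, a i ∈ V) ∧ x = t.2.realize fun i => (a i : M) := by
  refine or_congr Iff.rfl (exists_congr fun t => and_congr_right fun _ => ?_)
  constructor
  · rintro ⟨v, hv⟩
    choose a ha ha' using fun i => (v i).2
    exact ⟨a, ha, by simp only [hv, ha']⟩
  · rintro ⟨a, ha, hx⟩
    exact ⟨fun i => ⟨a i, a i, ha i, rfl⟩, hx⟩

/-- Renaming the elements of `V` in a term for a member of the hull. -/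
def relabelHull {K : Set (Σ n, L'.Term (Fin n))} {ι ι' : Type} (g : ι → ι')
    (s : L.Term (GenName K ι)) : L.Term (GenName K ι') :=
  s.relabel (Sum.map g (Sigma.map id fun _ p => g ∘ p))

theorem hullValue_relabelHull {K : Set (Σ n, L'.Term (Fin n))} {ι ι' : Type} (g : ι → ι')
    (s : L.Term (GenName K ι)) (a : ι' → U) :
    hullValue K a (relabelHull g s) = hullValue K (a ∘ g) s := by
  rw [hullValue, relabelHull, Term.realize_relabel, hullValue]
  congr 1
  ext (i | ⟨t, p⟩) <;> rfl

theorem hullValue_mem {K : Set (Σ n, L'.Term (Fin n))} {V : Set U} {ι : Type} {a : ι → U}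
    (ha : ∀ i, a i ∈ V) (s : L.Term (GenName K ι)) : hullValue K a s ∈ hull L K V := by
  refine s.realize_mem _ ?_
  rintro (i | ⟨t, p⟩) <;> refine Substructure.subset_closure (mem_kStarSet_image.2 ?_)
  · exact Or.inl ⟨_, ha i, rfl⟩
  · exact Or.inr ⟨t, t.2, a ∘ p, fun i => ha _, rfl⟩

theorem exists_hullValue_eq {K : Set (Σ n, L'.Term (Fin n))} {V : Set U} {x : M}
    (hx : x ∈ hull L K V) : ∃ (ι : Type) (_ : Finite ι) (a : ι → U) (_ : ∀ i, a i ∈ V)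
      (s : L.Term (GenName K ι)), hullValue K a s = x := by
  refine Substructure.closure_induction hx ?gen fun f x hx => ?func
  case gen =>
    intro x hx
    rcases mem_kStarSet_image.1 hx with ⟨u, hu, rfl⟩ | ⟨t, ht, a, ha, rfl⟩
    · exact ⟨Unit, inferInstance, fun _ => u, fun _ => hu, Term.var (Sum.inl ()), rfl⟩
    · exact ⟨Fin t.1, inferInstance, a, ha, Term.var (Sum.inr ⟨⟨t, ht⟩, id⟩), rfl⟩
  case func =>
    change ∃ _, _
    choose ι hι a ha s hs using hx
    refine ⟨Σ j, ι j, inferInstance, fun p => a p.1 p.2, fun p => ha _ _,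
      Term.func f fun j => relabelHull (Sigma.mk j) (s j), ?_⟩
    rw [hullValue, Term.realize_func]
    congr 1
    funext j
    rw [← hs j]
    exact hullValue_relabelHull _ _ _

/-- A finite tuple of members of the hull has a common finite support. -/
theorem exists_hullValue_eq_tuple {K : Set (Σ n, L'.Term (Fin n))} {V : Set U} {β : Type}
    [Finite β] {x : β → M} (hx : ∀ j, x j ∈ hull L K V) :
    ∃ (ι : Type) (_ : Finite ι) (a : ι → U) (_ : ∀ i, a i ∈ V)
      (s : β → L.Term (GenName K ι)), ∀ j, hullValue K a (s j) = x j := by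
  choose ι hι a ha s hs using fun j => exists_hullValue_eq (hx j)
  refine ⟨Σ j, ι j, inferInstance, fun p => a p.1 p.2, fun p => ha _ _,
    fun j => relabelHull (Sigma.mk j) (s j), fun j => ?_⟩
  rw [← hs j]
  exact hullValue_relabelHull _ _ _

theorem hull_mono {K K' : Set (Σ n, L'.Term (Fin n))} {V V' : Set U} (hK : K ⊆ K') (hV : V ⊆ V') :
    hull L K V ≤ hull L K' V' := by
  refine Substructure.closure_mono fun x hx => mem_kStarSet_image.2 ?_
  rcases mem_kStarSet_image.1 hx with ⟨u, hu, rfl⟩ | ⟨t, ht, a, ha, rfl⟩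
  · exact Or.inl ⟨u, hV hu, rfl⟩
  · exact Or.inr ⟨t, hK ht, a, fun i => hV (ha i), rfl⟩

/-- The hull is continuous in both arguments. -/
theorem exists_mem_hull_of_iUnion {ι : Type*} [Preorder ι] [IsDirectedOrder ι] [Nonempty ι]
    {K : ι → Set (Σ n, L'.Term (Fin n))} {V : ι → Set U} (hK : Monotone K) (hV : Monotone V)
    {x : M} (hx : x ∈ hull L (⋃ i, K i) (⋃ i, V i)) : ∃ i, x ∈ hull L (K i) (V i) := by
  refine Substructure.closure_induction hx ?gen fun f x hx => ?func
  case gen =>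
    intro x hx
    simp only [mem_kStarSet_image, Set.mem_iUnion] at hx
    rcases hx with ⟨u, ⟨i, hu⟩, rfl⟩ | ⟨t, ⟨i, ht⟩, a, ha, rfl⟩
    · exact ⟨i, Substructure.subset_closure (mem_kStarSet_image.2 (Or.inl ⟨u, hu, rfl⟩))⟩
    · choose j hj using ha
      obtain ⟨k, hk⟩ := Finite.exists_le j
      obtain ⟨l, hil, hkl⟩ := exists_ge_ge i k
      exact ⟨l, Substructure.subset_closure (mem_kStarSet_image.2 (Or.inr
        ⟨t, hK hil ht, a, fun m => hV ((hk m).trans hkl) (hj m), rfl⟩))⟩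
  case func =>
    change ∃ _, _
    choose i hi using hx
    obtain ⟨k, hk⟩ := Finite.exists_le i
    exact ⟨k, (hull L (K k) (V k)).fun_mem f x fun j => hull_mono (hK (hk j)) (hV (hk j)) (hi j)⟩

theorem exists_mem_hull_tuple_of_iUnion {ι : Type*} [Preorder ι] [IsDirectedOrder ι] [Nonempty ι]
    {K : ι → Set (Σ n, L'.Term (Fin n))} {V : ι → Set U} (hK : Monotone K) (hV : Monotone V)
    {β : Type} [Finite β] {x : β → M} (hx : ∀ j, x j ∈ hull L (⋃ i, K i) (⋃ i, V i)) :
    ∃ i, ∀ j, x j ∈ hull L (K i) (V i) := by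
  choose i hi using fun j => exists_mem_hull_of_iUnion hK hV (hx j)
  obtain ⟨k, hk⟩ := Finite.exists_le i
  exact ⟨k, fun j => hull_mono (hK (hk j)) (hV (hk j)) (hi j)⟩

/-- The `L'`-term in the elements of `V` expressing a member of the hull. -/
def toExpansionTerm (φL : L →ᴸ L') {K : Set (Σ n, L'.Term (Fin n))} {ι : Type}
    (s : L.Term (GenName K ι)) : L'.Term ι :=
  (φL.onTerm s).subst fun
    | .inl i => Term.var i
    | .inr ⟨t, p⟩ => t.1.2.relabel p

theorem realize_toExpansionTerm (φL : L →ᴸ L') [φL.IsExpansionOn M]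
    {K : Set (Σ n, L'.Term (Fin n))} {ι : Type} (s : L.Term (GenName K ι)) (a : ι → U) :
    (toExpansionTerm φL s).realize (fun i => (a i : M)) = hullValue K a s := by
  rw [toExpansionTerm, Term.realize_subst, LHom.realize_onTerm, hullValue]
  congr 1
  ext (i | ⟨t, p⟩)
  · rfl
  · exact Term.realize_relabel

end Hull

/-- `U` is a set of order-indiscernibles in the `L'`-structure `M`. -/
def Indisc (L' : FirstOrder.Language.{u, u}) {M : Type u} [L'.Structure M] (U : Set M)
    [LinearOrder U] : Prop :=
  ∀ (n : ℕ) (ψ : L'.Formula (Fin n)) (a b : Fin n → U), StrictMono a → StrictMono b →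
    (ψ.Realize (fun i => (a i : M)) ↔ ψ.Realize fun i => (b i : M))

section Transfer

variable {L L' : FirstOrder.Language.{u, u}} {M : Type u} [L.Structure M] [L'.Structure M]
  {U : Set M} [LinearOrder U]

/-- Tuples of hull elements given by the same terms over tuples with the same order pattern
satisfy the same formulas in hulls over dense orders without endpoints. -/
theorem satIn_hull_of_sameOrd (φL : L →ᴸ L') [φL.IsExpansionOn M] (hInd : Indisc L' U)
    (K : Set (Σ n, L'.Term (Fin n))) {β : Type}
    {n : ℕ} (φ : L.BoundedFormula β n) {ι : Type} [Finite ι] {V V' : Set U} (hV : IsDLO V)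
    (hV' : IsDLO V') {a a' : ι → U} (ha : ∀ i, a i ∈ V) (ha' : ∀ i, a' i ∈ V') (h : SameOrd a a')
    (s : β → L.Term (GenName K ι)) (t : Fin n → L.Term (GenName K ι)) :
    SatIn (hull L K V : Set M) φ (fun i => hullValue K a (s i)) (fun i => hullValue K a (t i)) →
      SatIn (hull L K V' : Set M) φ (fun i => hullValue K a' (s i))
        (fun i => hullValue K a' (t i)) := by
  have hs : ∀ {k : ℕ} {ι : Type} (a : ι → U) (s : β → L.Term (GenName K ι))
      (t : Fin k → L.Term (GenName K ι)) (r : L.Term (β ⊕ Fin k)),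
      r.realize (Sum.elim (fun i => hullValue K a (s i)) fun i => hullValue K a (t i)) =
        (toExpansionTerm φL (r.subst (Sum.elim s t))).realize fun i => (a i : M) := by
    intro k ι a s t r
    rw [realize_toExpansionTerm, hullValue, Term.realize_subst]
    congr 1
    ext (i | i) <;> rfl
  induction φ generalizing ι V V' with
  | falsum => exact id
  | equal r₁ r₂ =>
    simp only [SatIn, hs]
    simpa using (SameOrd.realize_iff hInd ((toExpansionTerm φL (r₁.subst (Sum.elim s t))).equal
      (toExpansionTerm φL (r₂.subst (Sum.elim s t)))) h).1
  | rel R ts =>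
    simp only [SatIn, hs]
    simpa using (SameOrd.realize_iff hInd ((φL.onRelation R).formula
      fun i => toExpansionTerm φL ((ts i).subst (Sum.elim s t))) h).1
  | imp φ ψ ih₁ ih₂ =>
    exact fun H hφ => ih₂ hV hV' ha ha' h s t (H (ih₁ hV' hV ha' ha h.symm s t hφ))
  | all φ ih =>
    intro H y hy
    obtain ⟨ι₂, _, c', hc', r, rfl⟩ := exists_hullValue_eq hy
    obtain ⟨c, hc, hac⟩ := h.exists_extend hV ha c'
    have := ih hV hV' (a := Sum.elim a c) (a' := Sum.elim a' c')
      (by rintro (i | i) <;> simp [ha, hc]) (by rintro (i | i) <;> simp [ha', hc']) hac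
      (fun i => relabelHull Sum.inl (s i))
      (Fin.snoc (fun i => relabelHull Sum.inl (t i)) (relabelHull Sum.inr r))
    have hsn : ∀ (a : ι → U) (c : ι₂ → U), (fun i => hullValue K (Sum.elim a c) ((Fin.snoc (fun i =>
        relabelHull (L := L) Sum.inl (t i)) (relabelHull Sum.inr r) : Fin _ → _) i)) =
        (Fin.snoc (fun i => hullValue K a (t i)) (hullValue K c r) : Fin _ → M) := fun a c => by
      funext i
      refine Fin.lastCases ?_ (fun i => ?_) i <;> simp [hullValue_relabelHull]
    simp only [hsn, hullValue_relabelHull, Sum.elim_comp_inl] at this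
    exact this (H _ (hullValue_mem hc r))

/-- Enlarging the dense order yields an elementary extension of hulls. -/
theorem satIn_hull_iff_of_subset (φL : L →ᴸ L') [φL.IsExpansionOn M] (hInd : Indisc L' U)
    (K : Set (Σ n, L'.Term (Fin n))) {β : Type}
    [Finite β] {n : ℕ} (φ : L.BoundedFormula β n) {V V' : Set U} (hV : IsDLO V) (hV' : IsDLO V')
    (hVV' : V ⊆ V') {v : β → M} {xs : Fin n → M} (hv : ∀ i, v i ∈ hull L K V)
    (hxs : ∀ i, xs i ∈ hull L K V) :
    SatIn (hull L K V : Set M) φ v xs ↔ SatIn (hull L K V' : Set M) φ v xs := by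
  obtain ⟨ι, _, a, ha, s, hs⟩ := exists_hullValue_eq_tuple (L := L) (K := K) (V := V)
    (x := Sum.elim v xs) (by rintro (i | i) <;> simp [hv, hxs])
  have hv' : v = fun i => hullValue K a (s (Sum.inl i)) := funext fun i => (hs (Sum.inl i)).symm
  have hxs' : xs = fun i => hullValue K a (s (Sum.inr i)) := funext fun i => (hs (Sum.inr i)).symm
  have hsame : SameOrd a a := fun _ _ => rfl
  rw [hv', hxs']
  exact ⟨satIn_hull_of_sameOrd φL hInd K φ hV hV' ha (fun i => hVV' (ha i)) hsame _ _,
    satIn_hull_of_sameOrd φL hInd K φ hV' hV (fun i => hVV' (ha i)) ha hsame _ _⟩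

/-- Elementarity of an inclusion of hulls over `U` can be tested over a dense suborder. -/
theorem satIn_hull_univ_iff (φL : L →ᴸ L') [φL.IsExpansionOn M] (hInd : Indisc L' U)
    {K K' : Set (Σ n, L'.Term (Fin n))}
    (hKK' : K ⊆ K') (hU : IsDLO (Set.univ : Set U)) {V : Set U} (hV : IsDLO V)
    {β : Type} [Finite β] {n : ℕ} (φ : L.BoundedFormula β n)
    (hel : ∀ (v : β → M) (xs : Fin n → M), (∀ i, v i ∈ hull L K V) → (∀ i, xs i ∈ hull L K V) →
      (SatIn (hull L K V : Set M) φ v xs ↔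
        SatIn (hull L K' (Set.univ : Set U) : Set M) φ v xs))
    {v : β → M} {xs : Fin n → M} (hv : ∀ i, v i ∈ hull L K (Set.univ : Set U))
    (hxs : ∀ i, xs i ∈ hull L K (Set.univ : Set U)) :
    SatIn (hull L K (Set.univ : Set U) : Set M) φ v xs ↔
      SatIn (hull L K' (Set.univ : Set U) : Set M) φ v xs := by
  obtain ⟨ι, _, a, ha, s, hs⟩ := exists_hullValue_eq_tuple (L := L) (K := K)
    (V := (Set.univ : Set U)) (x := Sum.elim v xs)
    (by rintro (i | i) <;> simp [hv, hxs])
  have hv' : v = fun i => hullValue K a (s (Sum.inl i)) := funext fun i => (hs (Sum.inl i)).symm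
  have hxs' : xs = fun i => hullValue K a (s (Sum.inr i)) := funext fun i => (hs (Sum.inr i)).symm
  obtain ⟨c, hc, hac⟩ := SameOrd.exists_extend hV (a := Empty.elim) (a' := Empty.elim)
    (fun i => i.elim) (fun i => i.elim) a
  have h : SameOrd c a := fun i j => hac (Sum.inr i) (Sum.inr j)
  let g : GenName K ι → GenName K' ι := Sum.map id (Sigma.map (Set.inclusion hKK') fun _ p => p)
  have hg : ∀ (a : ι → U) (s : L.Term (GenName K ι)),
      hullValue K a s = hullValue K' a (s.relabel g) := fun a s => by
    rw [hullValue, hullValue, Term.realize_relabel]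
    congr 1
    ext (i | ⟨t, p⟩) <;> rfl
  rw [hv', hxs']
  calc _ ↔ SatIn (hull L K V : Set M) φ (fun i => hullValue K c (s (Sum.inl i)))
          fun i => hullValue K c (s (Sum.inr i)) :=
        ⟨satIn_hull_of_sameOrd φL hInd K φ hU hV ha hc h.symm _ _,
          satIn_hull_of_sameOrd φL hInd K φ hV hU hc ha h _ _⟩
    _ ↔ SatIn (hull L K' (Set.univ : Set U) : Set M) φ (fun i => hullValue K c (s (Sum.inl i)))
          fun i => hullValue K c (s (Sum.inr i)) :=
        hel _ _ (fun i => hullValue_mem hc _) fun i => hullValue_mem hc _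
    _ ↔ _ := by
      simp only [hg]
      exact ⟨satIn_hull_of_sameOrd φL hInd K' φ hU hU (fun _ => Set.mem_univ _) ha h _ _,
        satIn_hull_of_sameOrd φL hInd K' φ hU hU ha (fun _ => Set.mem_univ _) h.symm _ _⟩

end Transfer

section Uniqueness

variable {L L' : FirstOrder.Language.{u, u}} {M : Type u} [L.Structure M] [L'.Structure M]
  {U : Set M}

theorem mk_kStarSet_univ {κ : Cardinal.{u}} (hκ : ℵ₀ < κ) (hU : #U = κ)
    {K : Set (Σ n, L'.Term (Fin n))} (hK : #K ≤ κ) :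
    #(KStarSet K (Subtype.val '' (Set.univ : Set U))) = κ := by
  refine le_antisymm ?_ ?_
  · have hsurj : KStarSet K (Subtype.val '' (Set.univ : Set U)) ⊆
        Set.range (Sum.elim (fun x : U => (x : M))
          fun p : Σ t : K, Fin t.1.1 → U => p.1.1.2.realize fun j => (p.2 j : M)) := by
      intro x hx
      rcases mem_kStarSet_image.1 hx with ⟨u, hu, rfl⟩ | ⟨t, ht, a, ha, rfl⟩
      · exact ⟨Sum.inl u, rfl⟩
      · exact ⟨Sum.inr ⟨⟨t, ht⟩, a⟩, rfl⟩
    refine (mk_le_mk_of_subset hsurj).trans (mk_range_le.trans ?_)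
    rw [mk_sum, lift_id, lift_id, mk_sigma, hU]
    refine add_le_of_le hκ.le le_rfl ((sum_le_sum _ (fun _ => κ) fun t => ?_).trans ?_)
    · simp only [mk_pi, hU, prod_const, mk_fin, lift_natCast, lift_uzero]
      exact_mod_cast power_nat_le hκ.le
    · rw [sum_const']
      exact (mul_le_mul_left hK κ).trans (mul_eq_self hκ.le).le
  · rw [← hU]
    exact mk_le_mk_of_subset fun x hx => Or.inl ⟨⟨x, hx⟩, trivial, rfl⟩

/-- If the hull of `V` contains every element of `U`, then `V` is all of `U`. -/
theorem eq_univ_of_subset_hull [LinearOrder U] [DenselyOrdered U] [NoMinOrder U] [NoMaxOrder U]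
    (φL : L →ᴸ L') [φL.IsExpansionOn M] (hInd : Indisc L' U) {K : Set (Σ n, L'.Term (Fin n))}
    {V : Set U} (h : ∀ u : U, (u : M) ∈ hull L K V) : V = Set.univ := by
  classical
  rw [Set.eq_univ_iff_forall]
  by_contra! hV
  obtain ⟨u, hu⟩ := hV
  obtain ⟨ι, _, a, ha, s, hs⟩ := exists_hullValue_eq (h u)
  have := Fintype.ofFinite ι
  let A : Finset U := Finset.univ.image a
  have hA : ∀ i, a i ∈ A := fun i => Finset.mem_image_of_mem _ (Finset.mem_univ i)
  have hne : ∀ i, a i ≠ u := fun i hi => hu (hi ▸ ha i)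
  have : Nonempty U := ⟨u⟩
  obtain ⟨w, hw₁, hw₂⟩ := Order.exists_between_finsets (insert u (A.filter (· < u)))
    (A.filter (u < ·)) (by
      intro x hx y hy
      rcases Finset.mem_insert.1 hx with rfl | hx
      · exact (Finset.mem_filter.1 hy).2
      · exact (Finset.mem_filter.1 hx).2.trans (Finset.mem_filter.1 hy).2)
  have huw : u < w := hw₁ u (Finset.mem_insert_self _ _)
  have hcmp : ∀ i, cmp (a i) u = cmp (a i) w := fun i => by
    rcases lt_or_gt_of_ne (hne i) with hi | hi
    · rw [(cmp_eq_lt_iff _ _).2 hi, (cmp_eq_lt_iff _ _).2 (hi.trans huw)]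
    · rw [(cmp_eq_gt_iff _ _).2 hi,
        (cmp_eq_gt_iff _ _).2 (hw₂ _ (Finset.mem_filter.2 ⟨hA i, hi⟩))]
  have hsame : SameOrd (Sum.elim a fun _ : Unit => u) (Sum.elim a fun _ : Unit => w) := by
    rintro (i | i) (j | j)
    · rfl
    · exact hcmp i
    · simpa [cmp_swap] using congrArg Ordering.swap (hcmp j)
    · simp
  have key := SameOrd.realize_iff hInd (((toExpansionTerm φL s).relabel Sum.inl).equal
    (Term.var (Sum.inr ()))) hsame
  simp only [Formula.realize_equal, Term.realize_relabel, Term.realize_var, Sum.elim_inr] at key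
  have hcomp : ∀ x : U, ((fun i => ((Sum.elim a (fun _ : Unit => x) i : U) : M)) ∘ Sum.inl) =
      fun i => (a i : M) := fun x => rfl
  simp only [hcomp, realize_toExpansionTerm, hs, true_iff] at key
  exact huw.ne (Subtype.ext key)

theorem hull_strictlyGenerated [LinearOrder U] [DenselyOrdered U] [NoMinOrder U] [NoMaxOrder U]
    (φL : L →ᴸ L') [φL.IsExpansionOn M] (hInd : Indisc L' U) {κ : Cardinal.{u}} (hκ : ℵ₀ < κ)
    (hU : #U = κ) {K : Set (Σ n, L'.Term (Fin n))} (hK : #K ≤ κ) :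
    StrictlyGenerated L (hull L K (Set.univ : Set U)) κ := by
  have himage : ∀ X : Set (hull L K (Set.univ : Set U)),
      (Substructure.closure L X).map (hull L K (Set.univ : Set U)).subtype.toHom =
        Substructure.closure L (Subtype.val '' X) := fun X => Substructure.map_closure _ X
  constructor
  · let X : Set (hull L K (Set.univ : Set U)) :=
      Subtype.val ⁻¹' KStarSet K (Subtype.val '' (Set.univ : Set U))
    have hX : Subtype.val '' X = KStarSet K (Subtype.val '' (Set.univ : Set U)) := by
      rw [Set.image_preimage_eq_iff]
      exact fun x hx => ⟨⟨x, Substructure.subset_closure hx⟩, rfl⟩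
    refine ⟨X, ?_, ?_⟩
    · rw [← mk_image_eq Subtype.val_injective, hX, mk_kStarSet_univ hκ hU hK]
    · refine eq_top_iff.2 fun x _ => ?_
      have hx : (x : M) ∈ (Substructure.closure L X).map
          (hull L K (Set.univ : Set U)).subtype.toHom := by
        rw [himage, hX]
        exact x.2
      obtain ⟨y, hy, hyx⟩ := Substructure.mem_map.1 hx
      exact Subtype.ext hyx ▸ hy
  · rintro ν hν ⟨X, hX, hgen⟩
    choose ι hι a ha s hs using fun x : X => exists_hullValue_eq x.1.2
    let V : Set U := ⋃ x : X, Set.range (a x)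
    have haV : ∀ x i, a x i ∈ V := fun x i => Set.mem_iUnion.2 ⟨x, i, rfl⟩
    have hXV : Subtype.val '' X ⊆ (hull L K V : Set M) := by
      rintro _ ⟨x, hx, rfl⟩
      rw [← hs ⟨x, hx⟩]
      exact hullValue_mem (haV _) _
    have hle : hull L K (Set.univ : Set U) ≤ hull L K V := by
      intro x hx
      have hx' : x ∈ (Substructure.closure L X).map
          (hull L K (Set.univ : Set U)).subtype.toHom := by
        rw [hgen]
        exact Substructure.mem_map.2 ⟨⟨x, hx⟩, trivial, rfl⟩
      rw [himage] at hx'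
      exact Substructure.closure_le.2 hXV hx'
    have hV : V = Set.univ := eq_univ_of_subset_hull φL hInd (K := K) fun u =>
      hle (show (u : M) ∈ hull L K Set.univ from
        Substructure.subset_closure (mem_kStarSet_image.2 (Or.inl ⟨u, trivial, rfl⟩)))
    have hcard : #V < κ := by
      refine (mk_iUnion_le_sum_mk.trans (sum_le_sum _ (fun _ => ℵ₀) fun x => ?_)).trans_lt ?_
      · exact mk_le_aleph0_iff.2 (Set.countable_range _).to_subtype
      · rw [sum_const', hX]
        exact mul_lt_of_lt hκ.le hν hκ
    rw [hV, mk_univ, hU] at hcard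
    exact hcard.false

theorem IsUniversalSentence.isUniversal {φ : L.Sentence} (h : IsUniversalSentence φ) :
    BoundedFormula.IsUniversal φ := by
  obtain ⟨n, ψ, hψ, rfl⟩ := h
  have : ∀ {n : ℕ} (ψ : L.BoundedFormula Empty n), ψ.IsUniversal →
      BoundedFormula.IsUniversal ψ.alls := by
    intro n
    induction n with
    | zero => exact fun ψ h => h
    | succ n ih => exact fun ψ h => ih ψ.all h.all
  exact this ψ hψ.isUniversal

/-- In a `κ`-unique universal theory, all hulls of sets of at most `κ` terms are isomorphic. -/
theorem nonempty_hull_equiv [LinearOrder U] [DenselyOrdered U] [NoMinOrder U] [NoMaxOrder U]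
    (φL : L →ᴸ L') [φL.IsExpansionOn M] (hInd : Indisc L' U) {T : L.Theory}
    (hT : IsUniversalTheory T) (hMT : M ⊨ T) {κ : Cardinal.{u}} (hκ : ℵ₀ < κ)
    (hTκ : KUnique T κ) (hU : #U = κ) {K K' : Set (Σ n, L'.Term (Fin n))} (hK : #K ≤ κ)
    (hK' : #K' ≤ κ) :
    Nonempty (hull L K (Set.univ : Set U) ≃[L] hull L K' (Set.univ : Set U)) := by
  have : T.IsUniversal := ⟨fun φ hφ => (hT φ hφ).isUniversal⟩
  exact hTκ.2 _ _ _ _ inferInstance inferInstance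
    (hull_strictlyGenerated φL hInd hκ hU hK) (hull_strictlyGenerated φL hInd hκ hU hK')

end Uniqueness

section Reflection

variable {L L' : FirstOrder.Language.{u, u}} {M : Type u} [L.Structure M] [L'.Structure M]

/-- The hull of `U` by the terms in `K` reflects in `M` all formulas of quantifier depth less
than `n`. -/
def Reflects (L : FirstOrder.Language.{u, u}) {L' : FirstOrder.Language.{u, u}} {M : Type u}
    [L.Structure M] [L'.Structure M] (U : Set M) (n : ℕ) (K : Set (Σ n, L'.Term (Fin n))) : Prop :=
  ∀ ⦃m k : ℕ⦄ (φ : L.BoundedFormula (Fin m) k), qdepth φ < n → ∀ (v : Fin m → M) (xs : Fin k → M),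
    (∀ i, v i ∈ hull L K (Set.univ : Set U)) → (∀ i, xs i ∈ hull L K (Set.univ : Set U)) →
      (SatIn (hull L K (Set.univ : Set U) : Set M) φ v xs ↔ SatIn Set.univ φ v xs)

variable {U : Set M}

theorem forall_snoc_mem {S : Set M} {k : ℕ} {xs : Fin k → M} (hxs : ∀ i, xs i ∈ S) {b : M}
    (hb : b ∈ S) (i : Fin (k + 1)) : (Fin.snoc xs b : Fin (k + 1) → M) i ∈ S := by
  refine Fin.lastCases ?_ (fun i => ?_) i <;> simp [hxs, hb]

theorem Reflects.mono {n n' : ℕ} (h : n ≤ n') {K : Set (Σ n, L'.Term (Fin n))}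
    (hK : Reflects L U n' K) : Reflects L U n K :=
  fun _ _ φ hφ => hK φ (hφ.trans_le h)

theorem reflects_zero (K : Set (Σ n, L'.Term (Fin n))) : Reflects L U 0 K :=
  fun _ _ _ hφ => absurd hφ (Nat.not_lt_zero _)

/-- Reflection is preserved under directed unions. -/
theorem Reflects.iUnion {ι : Type*} [Preorder ι] [IsDirectedOrder ι] [Nonempty ι]
    {K : ι → Set (Σ n, L'.Term (Fin n))} (hK : Monotone K) {n : ℕ}
    (h : ∀ i, Reflects L U n (K i)) : Reflects L U n (⋃ i, K i) := by
  intro m k φ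
  induction φ with
  | falsum => exact fun _ _ _ _ _ => Iff.rfl
  | equal => exact fun _ _ _ _ _ => Iff.rfl
  | rel => exact fun _ _ _ _ _ => Iff.rfl
  | imp φ ψ ih₁ ih₂ =>
    intro hφ v xs hv hxs
    simp only [qdepth, max_lt_iff] at hφ
    exact imp_congr (ih₁ hφ.1 v xs hv hxs) (ih₂ hφ.2 v xs hv hxs)
  | all φ ih =>
    intro hφ v xs hv hxs
    have hφ' : qdepth φ < n := (Nat.lt_succ_self _).trans hφ
    refine ⟨fun H => ?_, fun H x hx => (ih hφ' v _ hv (forall_snoc_mem hxs hx)).2 (H x trivial)⟩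
    obtain ⟨i, hi⟩ := exists_mem_hull_tuple_of_iUnion (L := L) hK
      (V := fun _ : ι => (Set.univ : Set U)) (fun _ _ _ => le_rfl) (x := Sum.elim v xs) (by
        rw [Set.iUnion_const]
        rintro (i | i) <;> simp [hv, hxs])
    have hvi := fun j => hi (Sum.inl j)
    have hxi := fun j => hi (Sum.inr j)
    refine (h i φ.all hφ v xs hvi hxi).1 fun x hx => ?_
    refine (h i φ hφ' v _ hvi (forall_snoc_mem hxi hx)).2 ?_
    have hx' := hull_mono (Set.subset_iUnion K i) le_rfl hx
    exact (ih hφ' v _ hv (forall_snoc_mem hxs hx')).1 (H x hx')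

/-- If reflection fails at the next quantifier depth, this is witnessed by a universal
quantifier. -/
theorem Reflects.exists_of_not_succ {n : ℕ} {K : Set (Σ n, L'.Term (Fin n))}
    (h : Reflects L U n K) (h' : ¬ Reflects L U (n + 1) K) :
    ∃ (m k : ℕ) (φ : L.BoundedFormula (Fin m) (k + 1)) (v : Fin m → M) (xs : Fin k → M) (b : M),
      qdepth φ < n ∧ (∀ i, v i ∈ hull L K (Set.univ : Set U)) ∧
      (∀ i, xs i ∈ hull L K (Set.univ : Set U)) ∧
      SatIn (hull L K (Set.univ : Set U) : Set M) φ.all v xs ∧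
      ¬ SatIn Set.univ φ v (Fin.snoc xs b) := by
  by_contra! hw
  refine h' fun m k φ => ?_
  induction φ with
  | falsum => exact fun _ _ _ _ _ => Iff.rfl
  | equal => exact fun _ _ _ _ _ => Iff.rfl
  | rel => exact fun _ _ _ _ _ => Iff.rfl
  | imp φ ψ ih₁ ih₂ =>
    intro hφ v xs hv hxs
    simp only [qdepth, max_lt_iff] at hφ
    exact imp_congr (ih₁ hφ.1 v xs hv hxs) (ih₂ hφ.2 v xs hv hxs)
  | all φ ih =>
    intro hφ v xs hv hxs
    have hφ' : qdepth φ < n := Nat.lt_of_succ_lt_succ hφ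
    exact ⟨fun H b _ => hw m _ φ v xs b hφ' hv hxs H,
      fun H x hx => (h φ hφ' v _ hv (forall_snoc_mem hxs hx)).2 (H x trivial)⟩

/-- Every element of an `L'`-structure generated by `U` lies in the hull of a single term. -/
theorem exists_mem_hull_singleton (hU : Substructure.closure L' U = ⊤) (b : M) :
    ∃ t : Σ n, L'.Term (Fin n), b ∈ hull L {t} (Set.univ : Set U) := by
  have hb : b ∈ Substructure.closure L' U := hU ▸ Substructure.mem_top b
  obtain ⟨t, rfl⟩ := Substructure.mem_closure_iff_exists_term.1 hb
  classical
  let e := t.varFinset.equivFin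
  refine ⟨⟨_, t.restrictVar fun x => e x⟩, Substructure.subset_closure
    (mem_kStarSet_image.2 (Or.inr ⟨_, rfl, fun i => (e.symm i).1, fun _ => trivial, ?_⟩))⟩
  exact (Term.realize_restrictVar (fun x : U => (x : M)) fun x => by simp).symm

end Reflection

section Chain

variable {W X : Type*} [LinearOrder W] [WellFoundedLT W]

/-- The continuous chain of sets, indexed by a well-order, whose successor steps apply `G`. -/
noncomputable def chain (G : Set X → Set X) : W → Set X :=
  wellFounded_lt.fix fun α ih => ⋃ β : Set.Iio α, G (ih β.1 β.2)

theorem chain_eq (G : Set X → Set X) (α : W) :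
    chain G α = ⋃ β : Set.Iio α, G (chain G β.1) :=
  wellFounded_lt.fix_eq _ α

theorem mem_chain {G : Set X → Set X} {α : W} {x : X} :
    x ∈ chain G α ↔ ∃ β < α, x ∈ G (chain G β) := by
  simp [chain_eq G α]

theorem subset_chain (G : Set X → Set X) {α β : W} (h : β < α) : G (chain G β) ⊆ chain G α :=
  fun _ hx => mem_chain.2 ⟨β, h, hx⟩

theorem chain_monotone (G : Set X → Set X) : Monotone (chain G : W → Set X) := fun α β h x hx => by
  obtain ⟨γ, hγ, hx⟩ := mem_chain.1 hx
  exact mem_chain.2 ⟨γ, hγ.trans_le h, hx⟩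

theorem countable_chain {G : Set X → Set X} (hG : ∀ K, K.Countable → (G K).Countable)
    (hW : ∀ α : W, (Set.Iio α).Countable) (α : W) : (chain G α).Countable := by
  induction α using WellFoundedLT.induction with
  | ind α ih =>
    rw [chain_eq]
    have := (hW α).to_subtype
    exact Set.countable_iUnion fun β => hG _ (ih _ β.2)

/-- At a limit of cofinality `ω`, the chain is the union of its values along a cofinal sequence. -/
theorem chain_eq_iUnion {G : Set X → Set X} (hG : ∀ K, K ⊆ G K) {α : W} {a : ℕ → W}
    (haα : ∀ k, a k < α) (hα : ∀ β < α, ∃ k, β ≤ a k) : chain G α = ⋃ k, G (chain G (a k)) := by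
  refine Set.Subset.antisymm (fun x hx => ?_) (Set.iUnion_subset fun k => subset_chain G (haα k))
  obtain ⟨β, hβ, hx⟩ := mem_chain.1 hx
  obtain ⟨k, hk⟩ := hα β hβ
  rcases hk.lt_or_eq with hk | rfl
  · exact Set.mem_iUnion.2 ⟨k, hG _ (subset_chain G hk hx)⟩
  · exact Set.mem_iUnion.2 ⟨k, hx⟩

/-- A construction extending countable sets can be iterated to a countable increasing sequence. -/
theorem exists_countable_seq {X : Type*} {P : ℕ → Set X → Prop}
    (h : ∀ n (K : Set X), K.Countable → ∃ K', K'.Countable ∧ K ⊆ K' ∧ P n K') {H : Set X}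
    (hH : H.Countable) :
    ∃ K : ℕ → Set X, Monotone K ∧ (∀ n, (K n).Countable) ∧ H ⊆ K 0 ∧ ∀ n, P n (K (n + 1)) := by
  choose F hFc hF hP using fun n (K : {K : Set X // K.Countable}) => h n K.1 K.2
  let K : ℕ → {K : Set X // K.Countable} := Nat.rec ⟨H, hH⟩ fun n K => ⟨F n K, hFc n K⟩
  exact ⟨fun n => (K n).1, monotone_nat_of_le_succ fun n => hF n (K n), fun n => (K n).2, le_rfl,
    fun n => hP n (K n)⟩

end Chain

section ClosingOff

variable {L L' : FirstOrder.Language.{u, u}} {M : Type u} [L.Structure M] [L'.Structure M]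
  {U : Set M}

theorem countable_kStarSet {K : Set (Σ n, L'.Term (Fin n))} (hK : K.Countable) {V : Set U}
    (hV : V.Countable) : (KStarSet K (Subtype.val '' V)).Countable := by
  have hK' := hK.to_subtype
  have hV' := hV.to_subtype
  refine (Set.countable_range (Sum.elim (fun x : V => ((x : U) : M))
    fun p : Σ t : K, Fin t.1.1 → V => p.1.1.2.realize fun j => ((p.2 j : U) : M))).mono ?_
  intro x hx
  rcases mem_kStarSet_image.1 hx with ⟨u, hu, rfl⟩ | ⟨t, ht, a, ha, rfl⟩
  · exact ⟨Sum.inl ⟨u, hu⟩, rfl⟩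
  · exact ⟨Sum.inr ⟨⟨t, ht⟩, fun i => ⟨a i, ha i⟩⟩, rfl⟩

/-- To check that an isomorphism of substructures maps the substructure generated by `X` into
`S`, it is enough to look at `X`. -/
theorem map_closure_mem {A B S : L.Substructure M} (f : A ≃[L] B) {X : Set M} (hXA : X ⊆ A)
    (h : ∀ x : A, (x : M) ∈ X → (f x : M) ∈ S) {x : A}
    (hx : (x : M) ∈ Substructure.closure L X) : (f x : M) ∈ S := by
  suffices ∀ y ∈ Substructure.closure L X, ∃ hy : y ∈ A, (f ⟨y, hy⟩ : M) ∈ S from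
    (this x hx).2
  intro y hy
  refine Substructure.closure_induction hy (fun y hy => ⟨hXA hy, h _ hy⟩) fun F y hy => ?_
  change ∃ _, _
  choose hyA hyS using hy
  refine ⟨A.fun_mem F y hyA, ?_⟩
  have : f ⟨Structure.funMap F y, A.fun_mem F y hyA⟩ =
      Structure.funMap F fun i => f ⟨y i, hyA i⟩ :=
    HomClass.map_fun f F fun i => (⟨y i, hyA i⟩ : A)
  rw [this]
  exact S.fun_mem F _ hyS

/-- A countable subset of the hull is contained in an early hull of a countable set. -/
theorem exists_countable_subset_hull {W : Type*} [LinearOrder W]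
    (hW : ∀ s : Set W, s.Countable → ∃ α, ∀ x ∈ s, x < α)
    {J : W → Set (Σ n, L'.Term (Fin n))} (hJ : Monotone J) {X : Set M} (hX : X.Countable)
    (hXJ : ∀ x ∈ X, x ∈ hull L (⋃ α, J α) (Set.univ : Set U)) :
    ∃ (α : W) (V : Set U), V.Countable ∧ ∀ x ∈ X, x ∈ hull L (J α) V := by
  classical
  obtain ⟨α₀, -⟩ := hW ∅ Set.countable_empty
  have : Nonempty W := ⟨α₀⟩
  have hJ' : (⋃ p : W × Finset U, J p.1) = ⋃ α, J α := by
    ext; simp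
  have hU : (⋃ p : W × Finset U, (p.2 : Set U)) = Set.univ :=
    Set.eq_univ_of_forall fun u => Set.mem_iUnion.2 ⟨(α₀, {u}), by simp⟩
  have h : ∀ x : X, ∃ p : W × Finset U, (x : M) ∈ hull L (J p.1) (p.2 : Set U) := fun x =>
    exists_mem_hull_of_iUnion (K := fun p : W × Finset U => J p.1)
      (V := fun p : W × Finset U => (p.2 : Set U)) (fun p q hpq => hJ (Prod.le_def.1 hpq).1)
      (fun p q hpq => Finset.coe_subset.2 (Prod.le_def.1 hpq).2) (by rw [hJ', hU]; exact hXJ x x.2)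
  choose p hp using h
  have := hX.to_subtype
  obtain ⟨α, hα⟩ := hW _ (Set.countable_range fun x => (p x).1)
  exact ⟨α, ⋃ x, ((p x).2 : Set U), Set.countable_iUnion fun x => (p x).2.countable_toSet,
    fun x hx => hull_mono (hJ (hα _ ⟨⟨x, hx⟩, rfl⟩).le)
      (Set.subset_iUnion (fun x => ((p x).2 : Set U)) ⟨x, hx⟩) (hp ⟨x, hx⟩)⟩

/-- A countable set of points can be enlarged so that it fills all its gaps. -/
theorem exists_countable_fill {α : Type*} [LinearOrder α] [DenselyOrdered α] [NoMinOrder α]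
    [NoMaxOrder α] {V : Set α} (hV : V.Countable) :
    ∃ V' : Set α, V'.Countable ∧ (∀ u ∈ V, ∃ w ∈ V', w < u) ∧ (∀ u ∈ V, ∃ w ∈ V', u < w) ∧
      ∀ u ∈ V, ∀ u' ∈ V, u < u' → ∃ w ∈ V', u < w ∧ w < u' := by
  choose lo hlo using fun u : α => exists_lt u
  choose hi hhi using fun u : α => exists_gt u
  choose mid hmid using fun p : {p : α × α // p.1 < p.2} => exists_between p.2
  have hV' := hV.to_subtype
  let g : V × V → α := fun p => if h : (p.1 : α) < p.2 then mid ⟨(p.1, p.2), h⟩ else p.1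
  refine ⟨lo '' V ∪ hi '' V ∪ Set.range g,
    ((hV.image _).union (hV.image _)).union (Set.countable_range _),
    fun u hu => ⟨lo u, by simp [Set.mem_image_of_mem lo hu], hlo u⟩,
    fun u hu => ⟨hi u, by simp [Set.mem_image_of_mem hi hu], hhi u⟩, fun u hu u' hu' h =>
    ⟨g (⟨u, hu⟩, ⟨u', hu'⟩), by simp, ?_⟩⟩
  simpa [g, h] using hmid ⟨(u, u'), h⟩

end ClosingOff

section Stage

variable {L L' : FirstOrder.Language.{u, u}} {M : Type u} [L.Structure M] [L'.Structure M]
  {U : Set M}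

/-- The image of the hull of a countable set under an isomorphism onto the hull of a chain is
contained in an early hull of a countable set. -/
theorem exists_countable_image_subset_hull {W : Type*} [LinearOrder W]
    (hW : ∀ s : Set W, s.Countable → ∃ α, ∀ x ∈ s, x < α)
    {J : W → Set (Σ n, L'.Term (Fin n))} (hJ : Monotone J) {K K₀ : Set (Σ n, L'.Term (Fin n))}
    (hK₀ : K₀.Countable) (hK : K₀ ⊆ K) {V : Set U} (hV : V.Countable)
    (f : hull L K (Set.univ : Set U) ≃[L] hull L (⋃ α, J α) (Set.univ : Set U)) :
    ∃ (α : W) (V' : Set U), V'.Countable ∧ ∀ x : hull L K (Set.univ : Set U),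
      (x : M) ∈ hull L K₀ V → (f x : M) ∈ hull L (J α) V' := by
  obtain ⟨α, V', hV', h⟩ := exists_countable_subset_hull (L := L) hW hJ
    (X := (fun x => (f x : M)) '' (Subtype.val ⁻¹' KStarSet K₀ (Subtype.val '' V)))
    (((countable_kStarSet hK₀ hV).preimage Subtype.val_injective).image _) (by
      rintro _ ⟨x, -, rfl⟩
      exact (f x).2)
  exact ⟨α, V', hV', fun x hx => map_closure_mem f
    (Substructure.subset_closure.trans (hull_mono hK (Set.subset_univ V)))
    (fun x hx => h _ ⟨x, hx, rfl⟩) hx⟩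

/-- An isomorphism of the hull without additional terms onto the hull of a chain of length `ω₁`
restricts to an isomorphism of hulls over a dense suborder at some limit stage. -/
theorem exists_stage_restrict [LinearOrder U] [DenselyOrdered U] [NoMinOrder U] [NoMaxOrder U]
    [Nonempty U] {W : Type*} [LinearOrder W] [WellFoundedLT W]
    (hW : ∀ s : Set W, s.Countable → ∃ α, ∀ x ∈ s, x < α)
    {J : W → Set (Σ n, L'.Term (Fin n))} (hJ : Monotone J) (hJc : ∀ α, (J α).Countable)
    (f : hull L (∅ : Set (Σ n, L'.Term (Fin n))) (Set.univ : Set U) ≃[L]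
      hull L (⋃ α, J α) (Set.univ : Set U)) :
    ∃ (a : ℕ → W) (α : W), StrictMono a ∧ (∀ k, a k < α) ∧ (∀ β < α, ∃ k, β ≤ a k) ∧
      (J α = ⋃ k, J (a k) → ∃ V : Set U, IsDLO V ∧
        ∀ x : hull L (∅ : Set (Σ n, L'.Term (Fin n))) (Set.univ : Set U),
          (x : M) ∈ hull L (∅ : Set (Σ n, L'.Term (Fin n))) V ↔ (f x : M) ∈ hull L (J α) V) := by
  have step : ∀ p : {p : W × Set U // p.2.Countable}, ∃ q : {p : W × Set U // p.2.Countable},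
      p.1.1 < q.1.1 ∧ p.1.2 ⊆ q.1.2 ∧
      (∀ x : hull L (∅ : Set (Σ n, L'.Term (Fin n))) (Set.univ : Set U),
        (x : M) ∈ hull L (∅ : Set (Σ n, L'.Term (Fin n))) p.1.2 →
          (f x : M) ∈ hull L (J q.1.1) q.1.2) ∧
      (∀ x : hull L (∅ : Set (Σ n, L'.Term (Fin n))) (Set.univ : Set U),
        (f x : M) ∈ hull L (J p.1.1) p.1.2 →
          (x : M) ∈ hull L (∅ : Set (Σ n, L'.Term (Fin n))) q.1.2) ∧
      (∀ u ∈ p.1.2, ∃ w ∈ q.1.2, w < u) ∧ (∀ u ∈ p.1.2, ∃ w ∈ q.1.2, u < w) ∧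
      ∀ u ∈ p.1.2, ∀ u' ∈ p.1.2, u < u' → ∃ w ∈ q.1.2, u < w ∧ w < u' := by
    rintro ⟨⟨α, V⟩, hV : V.Countable⟩
    obtain ⟨α₁, V₁, hV₁, h₁⟩ := exists_countable_image_subset_hull hW hJ Set.countable_empty
      le_rfl hV f
    have he : (⋃ _ : W, (∅ : Set (Σ n, L'.Term (Fin n)))) = ∅ := Set.iUnion_empty
    have h := exists_countable_image_subset_hull (L := L) hW
      (J := fun _ => (∅ : Set (Σ n, L'.Term (Fin n)))) monotone_const (hJc α)
      (Set.subset_iUnion J α) hV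
    rw [he] at h
    obtain ⟨-, V₂, hV₂, h₂⟩ := h f.symm
    obtain ⟨V₃, hV₃, hlo, hhi, hmid⟩ := exists_countable_fill hV
    obtain ⟨α', hα'⟩ := hW {α, α₁} (by simp)
    have hα₁ := hα' α₁ (by simp)
    refine ⟨⟨(α', V ∪ V₁ ∪ V₂ ∪ V₃), ((hV.union hV₁).union hV₂).union hV₃⟩, hα' α (by simp),
      ?_, fun x hx => ?_, fun x hx => ?_, ?_, ?_, ?_⟩
    · exact fun x hx => by simp [hx]
    · exact hull_mono (hJ hα₁.le) (fun x hx => by simp [hx]) (h₁ x hx)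
    · have := h₂ (f x) hx
      rw [f.symm_apply_apply] at this
      exact hull_mono le_rfl (fun x hx => by simp [hx]) this
    · exact fun u hu => (hlo u hu).imp fun w hw => ⟨Or.inr hw.1, hw.2⟩
    · exact fun u hu => (hhi u hu).imp fun w hw => ⟨Or.inr hw.1, hw.2⟩
    · exact fun u hu u' hu' h => (hmid u hu u' hu' h).imp fun w hw => ⟨Or.inr hw.1, hw.2⟩
  choose F hF using step
  obtain ⟨α₀, -⟩ := hW ∅ Set.countable_empty
  obtain ⟨u₀⟩ := ‹Nonempty U›
  let p : ℕ → {p : W × Set U // p.2.Countable} := fun k =>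
    F^[k] ⟨(α₀, {u₀}), Set.countable_singleton u₀⟩
  have hp : ∀ k, p (k + 1) = F (p k) := fun k => Function.iterate_succ_apply' F k _
  have hstep := fun k => hF (p k)
  simp only [← hp] at hstep
  have hα : StrictMono fun k => (p k).1.1 := strictMono_nat_of_lt_succ fun k => (hstep k).1
  have hV : Monotone fun k => (p k).1.2 := monotone_nat_of_le_succ fun k => (hstep k).2.1
  obtain ⟨α, hαp, hmin⟩ := wellFounded_lt.has_min {α | ∀ k, (p k).1.1 < α} (by
    obtain ⟨α, h⟩ := hW _ (Set.countable_range fun k => (p k).1.1)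
    exact ⟨α, fun k => h _ ⟨k, rfl⟩⟩)
  refine ⟨fun k => (p k).1.1, α, hα, hαp, fun β hβ => ?_, fun hJα => ⟨⋃ k, (p k).1.2, ?_, ?_⟩⟩
  · by_contra! h
    exact hmin β h hβ
  · refine ⟨⟨u₀, Set.mem_iUnion.2 ⟨0, rfl⟩⟩, fun u hu => ?_, fun u hu => ?_,
      fun u hu u' hu' h => ?_⟩
    · obtain ⟨k, hk⟩ := Set.mem_iUnion.1 hu
      obtain ⟨w, hw, h⟩ := (hstep k).2.2.2.2.1 u hk
      exact ⟨w, Set.mem_iUnion.2 ⟨_, hw⟩, h⟩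
    · obtain ⟨k, hk⟩ := Set.mem_iUnion.1 hu
      obtain ⟨w, hw, h⟩ := (hstep k).2.2.2.2.2.1 u hk
      exact ⟨w, Set.mem_iUnion.2 ⟨_, hw⟩, h⟩
    · obtain ⟨k, hk⟩ := Set.mem_iUnion.1 hu
      obtain ⟨l, hl⟩ := Set.mem_iUnion.1 hu'
      obtain ⟨w, hw, h⟩ := (hstep (max k l)).2.2.2.2.2.2 u (hV (le_max_left k l) hk) u'
        (hV (le_max_right k l) hl) h
      exact ⟨w, Set.mem_iUnion.2 ⟨_, hw⟩, h⟩
  · intro x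
    constructor
    · intro hx
      have he : (⋃ _ : ℕ, (∅ : Set (Σ n, L'.Term (Fin n)))) = ∅ := Set.iUnion_empty
      obtain ⟨k, hk⟩ := exists_mem_hull_of_iUnion (L := L) (x := (x : M)) monotone_const hV
        (by rw [he]; exact hx)
      exact hull_mono (hJ (hαp _).le) (Set.subset_iUnion (fun k => (p k).1.2) (k + 1))
        ((hstep k).2.2.1 x hk)
    · intro hx
      rw [hJα] at hx
      obtain ⟨k, hk⟩ := exists_mem_hull_of_iUnion (hJ.comp hα.monotone) hV hx
      exact hull_mono le_rfl (Set.subset_iUnion (fun k => (p k).1.2) (k + 1))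
        ((hstep k).2.2.2.1 x hk)

/-- An isomorphism as in `exists_stage_restrict` makes some limit stage of the chain elementary
in the whole. -/
theorem exists_stage_elementary [LinearOrder U] [DenselyOrdered U] [NoMinOrder U] [NoMaxOrder U]
    [Nonempty U] (φL : L →ᴸ L') [φL.IsExpansionOn M] (hInd : Indisc L' U)
    {W : Type*} [LinearOrder W] [WellFoundedLT W]
    (hW : ∀ s : Set W, s.Countable → ∃ α, ∀ x ∈ s, x < α) (hWI : ∀ α : W, (Set.Iio α).Countable)
    {G : Set (Σ n, L'.Term (Fin n)) → Set (Σ n, L'.Term (Fin n))} (hG : ∀ K, K ⊆ G K)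
    (hGc : ∀ K, K.Countable → (G K).Countable)
    (f : hull L (∅ : Set (Σ n, L'.Term (Fin n))) (Set.univ : Set U) ≃[L]
      hull L (⋃ α : W, chain G α) (Set.univ : Set U)) :
    ∃ (a : ℕ → W) (α : W), StrictMono a ∧ chain G α = ⋃ k, G (chain G (a k)) ∧
      ∀ {m k : ℕ} (φ : L.BoundedFormula (Fin m) k) (v : Fin m → M) (xs : Fin k → M),
        (∀ i, v i ∈ hull L (chain G α) (Set.univ : Set U)) →
        (∀ i, xs i ∈ hull L (chain G α) (Set.univ : Set U)) →
        (SatIn (hull L (chain G α) (Set.univ : Set U) : Set M) φ v xs ↔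
          SatIn (hull L (⋃ α : W, chain G α) (Set.univ : Set U) : Set M) φ v xs) := by
  obtain ⟨a, α, ha, haα, hα, h⟩ :=
    exists_stage_restrict hW (chain_monotone G) (countable_chain hGc hWI) f
  have hchain := chain_eq_iUnion hG haα hα
  obtain ⟨V, hV, hfV⟩ := h (by
    refine Set.Subset.antisymm ?_ (Set.iUnion_subset fun k => chain_monotone G (haα k).le)
    rw [hchain]
    exact Set.iUnion_subset fun k => (subset_chain G (ha (Nat.lt_succ_self k))).trans
      (Set.subset_iUnion (fun k => chain G (a k)) (k + 1)))
  have hsub : chain G α ⊆ ⋃ α : W, chain G α := Set.subset_iUnion _ α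
  refine ⟨a, α, ha, hchain, fun φ v xs hv hxs =>
    satIn_hull_univ_iff φL hInd hsub .univ hV φ (fun v xs hv hxs => ?_) hv hxs⟩
  have hsub' : hull L (chain G α) V ≤ hull L (⋃ α : W, chain G α) Set.univ :=
    hull_mono hsub (Set.subset_univ V)
  have hsub₀ : hull L (∅ : Set (Σ n, L'.Term (Fin n))) V ≤ hull L ∅ Set.univ :=
    hull_mono le_rfl (Set.subset_univ V)
  obtain ⟨v, rfl⟩ : ∃ v' : _ → hull L (∅ : Set (Σ n, L'.Term (Fin n))) (Set.univ : Set U),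
      (fun i => (f (v' i) : M)) = v := ⟨fun i => f.symm ⟨v i, hsub' (hv i)⟩, by simp⟩
  obtain ⟨xs, rfl⟩ : ∃ xs' : _ → hull L (∅ : Set (Σ n, L'.Term (Fin n))) (Set.univ : Set U),
      (fun i => (f (xs' i) : M)) = xs := ⟨fun i => f.symm ⟨xs i, hsub' (hxs i)⟩, by simp⟩
  rw [← satIn_equiv f hsub₀ hsub' hfV, ← satIn_equiv f le_rfl le_rfl (by simp),
    satIn_hull_iff_of_subset φL hInd ∅ φ hV .univ (Set.subset_univ V)
      (fun i => (hfV _).2 (hv i)) fun i => (hfV _).2 (hxs i)]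

end Stage

section Reflecting

variable {L L' : FirstOrder.Language.{u, u}} {M : Type u} [L.Structure M] [L'.Structure M]
  {U : Set M}

theorem countable_Iio_toType (α : (ℵ₁ : Cardinal.{u}).ord.ToType) : (Set.Iio α).Countable := by
  rw [← le_aleph0_iff_set_countable, ← Order.lt_succ_iff, succ_aleph0]
  simpa using mk_Iio_lt α (by simp)

theorem exists_forall_lt_toType (s : Set (ℵ₁ : Cardinal.{u}).ord.ToType) (hs : s.Countable) :
    ∃ α, ∀ x ∈ s, x < α := by
  by_contra! h
  have hc : (⋃ x ∈ s, Set.Iic x).Countable := hs.biUnion fun x _ => by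
    rw [← Set.Iio_insert]
    exact (countable_Iio_toType x).insert x
  have hu : (⋃ x ∈ s, Set.Iic x) = Set.univ := Set.eq_univ_of_forall fun α => by
    obtain ⟨x, hx, hα⟩ := h α
    exact Set.mem_biUnion hx hα
  rw [hu, ← le_aleph0_iff_set_countable, mk_univ, mk_ord_toType] at hc
  exact aleph0_lt_aleph_one.not_ge hc

/-- Every countable set of terms extends to a countable set of terms whose hull reflects formulas
of quantifier depth less than `n`. -/
theorem exists_countable_reflects [LinearOrder U] [DenselyOrdered U] [NoMinOrder U] [NoMaxOrder U]
    [Nonempty U] (φL : L →ᴸ L') [φL.IsExpansionOn M] (hInd : Indisc L' U) {T : L.Theory}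
    (hT : IsUniversalTheory T) (hMT : M ⊨ T) {κ : Cardinal.{u}} (hκ : ℵ₀ < κ)
    (hTκ : KUnique T κ) (hU : #U = κ) (hUgen : Substructure.closure L' U = ⊤) (n : ℕ)
    {H : Set (Σ n, L'.Term (Fin n))} (hH : H.Countable) :
    ∃ K, K.Countable ∧ H ⊆ K ∧ Reflects L U n K := by
  induction n generalizing H with
  | zero => exact ⟨H, hH, le_rfl, reflects_zero H⟩
  | succ n ih =>
    by_contra! hnot
    have hex : ∀ K : Set (Σ n, L'.Term (Fin n)), ∃ K', K ⊆ K' ∧ (K.Countable → K'.Countable ∧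
        H ⊆ K' ∧ Reflects L U n K' ∧ (H ⊆ K → Reflects L U n K →
          ∃ (m k : ℕ) (φ : L.BoundedFormula (Fin m) (k + 1)) (v : Fin m → M) (xs : Fin k → M),
            ∃ b ∈ hull L K' (Set.univ : Set U), qdepth φ < n ∧
            (∀ i, v i ∈ hull L K (Set.univ : Set U)) ∧
            (∀ i, xs i ∈ hull L K (Set.univ : Set U)) ∧
            SatIn (hull L K (Set.univ : Set U) : Set M) φ.all v xs ∧
            ¬ SatIn Set.univ φ v (Fin.snoc xs b))) := by
      intro K
      by_cases hKc : K.Countable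
      swap
      · exact ⟨K, le_rfl, fun h => absurd h hKc⟩
      by_cases hK : H ⊆ K ∧ Reflects L U n K
      · obtain ⟨m, k, φ, v, xs, b, hφ, hv, hxs, hall, hb⟩ :=
          Reflects.exists_of_not_succ hK.2 (hnot K hKc hK.1)
        obtain ⟨t, ht⟩ := exists_mem_hull_singleton (L := L) hUgen b
        obtain ⟨K', hK'c, hKK', hK'⟩ := ih (hKc.insert t)
        exact ⟨K', (Set.subset_insert _ _).trans hKK', fun _ => ⟨hK'c,
          hK.1.trans ((Set.subset_insert _ _).trans hKK'), hK', fun _ _ => ⟨m, k, φ, v, xs, b,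
            hull_mono (Set.singleton_subset_iff.2 (hKK' (Set.mem_insert _ _))) le_rfl ht,
            hφ, hv, hxs, hall, hb⟩⟩⟩
      · obtain ⟨K', hK'c, hKK', hK'⟩ := ih (hKc.union hH)
        exact ⟨K', Set.subset_union_left.trans hKK', fun _ => ⟨hK'c,
          Set.subset_union_right.trans hKK', hK', fun h₁ h₂ => absurd ⟨h₁, h₂⟩ hK⟩⟩
    choose G hG hG' using hex
    let W := (ℵ₁ : Cardinal.{u}).ord.ToType
    have hGc : ∀ K, K.Countable → (G K).Countable := fun K hK => (hG' K hK).1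
    have hc : ∀ α : W, (chain G α).Countable := countable_chain hGc countable_Iio_toType
    have hsub : ∀ α : W, chain G α ⊆ ⋃ α : W, chain G α := Set.subset_iUnion _
    have hcard : #(⋃ α : W, chain G α : Set (Σ n, L'.Term (Fin n))) ≤ κ := by
      refine (mk_iUnion_le_sum_mk.trans (sum_le_sum _ (fun _ => ℵ₀) fun α =>
        mk_le_aleph0_iff.2 (hc α).to_subtype)).trans ?_
      rw [sum_const', mk_ord_toType, aleph_mul_aleph0, ← Cardinal.succ_aleph0]
      exact Order.succ_le_of_lt hκ
    obtain ⟨f⟩ := nonempty_hull_equiv φL hInd hT hMT hκ hTκ hU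
      (K := (∅ : Set (Σ n, L'.Term (Fin n)))) (by simp) hcard
    obtain ⟨a, α, ha, hα, hel⟩ := exists_stage_elementary φL hInd exists_forall_lt_toType
      countable_Iio_toType hG hGc f
    have hmono : Monotone fun k => G (chain G (a k)) := monotone_nat_of_le_succ fun k =>
      (subset_chain G (ha (Nat.lt_succ_self k))).trans (hG _)
    have hHα : H ⊆ chain G α := by
      rw [hα]
      exact (hG' _ (hc (a 0))).2.1.trans (Set.subset_iUnion (fun k => G (chain G (a k))) 0)
    have hgood : Reflects L U n (chain G α) := by
      rw [hα]
      exact Reflects.iUnion hmono fun k => (hG' _ (hc (a k))).2.2.1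
    obtain ⟨m, k, φ, v, xs, b, hb, hφ, hv, hxs, hall, hnb⟩ := (hG' _ (hc α)).2.2.2 hHα hgood
    obtain ⟨β, hβ⟩ := exists_forall_lt_toType {α} (Set.countable_singleton α)
    have hb' : b ∈ hull L (⋃ α : W, chain G α) (Set.univ : Set U) :=
      hull_mono ((subset_chain G (hβ α rfl)).trans (hsub β)) le_rfl hb
    have hle := hull_mono (L := L) (hsub α) (le_refl (Set.univ : Set U))
    have hgood' : Reflects L U n (⋃ α : W, G (chain G α)) :=
      have : Nonempty W := ⟨α⟩
      Reflects.iUnion (monotone_iff_forall_lt.2 fun α β h => (subset_chain G h).trans (hG _))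
        fun α => (hG' _ (hc α)).2.2.1
    have heq : (⋃ α : W, G (chain G α)) = ⋃ α : W, chain G α := by
      refine Set.Subset.antisymm (Set.iUnion_subset fun α => ?_)
        (Set.iUnion_mono fun α => hG _)
      obtain ⟨β, hβ⟩ := exists_forall_lt_toType {α} (Set.countable_singleton α)
      exact (subset_chain G (hβ α rfl)).trans (hsub β)
    rw [heq] at hgood'
    refine hnb ((hgood' φ hφ v _ (fun i => hle (hv i))
      (forall_snoc_mem (fun i => hle (hxs i)) hb')).1 ?_)
    exact (hel φ.all v xs hv hxs).1 hall b hb'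

/-- A hull reflecting formulas of all quantifier depths is an elementary substructure. -/
theorem isElementary_of_reflects {K : Set (Σ n, L'.Term (Fin n))} (h : ∀ n, Reflects L U n K) :
    (Substructure.closure L (KStarSet K U)).IsElementary := by
  rw [← Subtype.coe_image_univ U]
  intro n φ v
  have := h _ φ (Nat.lt_succ_self _) (fun i => v i)
    (fun i => ((default : Fin 0 → hull L K (Set.univ : Set U)) i : M)) (fun i => (v i).2)
    fun i => i.elim0
  rw [satIn_coe, satIn_univ] at this
  rw [Formula.Realize, Formula.Realize, ← Subsingleton.elim
    (fun i => ((default : Fin 0 → hull L K (Set.univ : Set U)) i : M)) default]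
  exact this.symm

end Reflecting

/-- Let `T` be a universal theory that is `κ`-unique for some uncountable `κ`, let `L'` be a
Skolem expansion of `L` for `M'`, whose `L`-reduct `M` is a model of `T`, and let `U` be a dense
linear order without endpoints of cardinality `κ` generating `M'` and consisting of
order-indiscernibles for all `L'`-formulas. Then every countable set `H` of `L'`-terms extends
to a countable set `K` of `L'`-terms such that `Sg^M(K*U)` is an elementary substructure
of `M`. -/
theorem stmt10 {L L' : FirstOrder.Language.{u, u}} (φL : L →ᴸ L')
    (T : L.Theory) (hTuniv : IsUniversalTheory T)
    (κ : Cardinal.{u}) (hκ : ℵ₀ < κ) (hTκ : KUnique T κ)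
    (M : Type u) [L.Structure M] [L'.Structure M] [φL.IsExpansionOn M]
    (hMT : M ⊨ T)
    (hSkolem : ∀ (n : ℕ) (ψ : L'.Formula (Fin (n + 1))), ∃ t : L'.Term (Fin n),
      ∀ v : Fin n → M, (∃ x : M, ψ.Realize (Fin.cons x v)) → ψ.Realize (Fin.cons (t.realize v) v))
    (U : Set M) [LinearOrder ↥U] [DenselyOrdered ↥U] [NoMinOrder ↥U] [NoMaxOrder ↥U]
    (hUne : U.Nonempty) (hUcard : #U = κ)
    (hUgen : Substructure.closure L' U = ⊤)
    (hInd : ∀ (n : ℕ) (ψ : L'.Formula (Fin n)) (a b : Fin n → ↥U),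
      StrictMono a → StrictMono b →
      (ψ.Realize (fun i => (a i : M)) ↔ ψ.Realize fun i => (b i : M)))
    (H : Set (Σ n, L'.Term (Fin n))) (hH : H.Countable) :
    ∃ K : Set (Σ n, L'.Term (Fin n)), K.Countable ∧ H ⊆ K ∧
      (Substructure.closure L (KStarSet K U)).IsElementary := by
  have : Nonempty U := hUne.to_subtype
  obtain ⟨K, hK, hKc, hHK, hKr⟩ := exists_countable_seq (P := Reflects L U) (fun n _ hK =>
    exists_countable_reflects φL hInd hTuniv hMT hκ hTκ hUcard hUgen n hK) hH
  refine ⟨⋃ n, K n, Set.countable_iUnion hKc, hHK.trans (Set.subset_iUnion K 0),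
    isElementary_of_reflects fun n => ?_⟩
  have htail : (⋃ k, K k) = ⋃ k, K (n + k + 1) :=
    Set.Subset.antisymm (Set.iUnion_mono fun k => hK (show k ≤ n + k + 1 by omega))
      (Set.iUnion_subset fun k => Set.subset_iUnion K (n + k + 1))
  rw [htail]
  exact Reflects.iUnion (fun i j h => hK (by gcongr)) fun k =>
    Reflects.mono (Nat.le_add_right n k) (hKr (n + k))
end

section
/- Let T be a universal theory in a first-order language L that is κ-unique for some uncountable cardinal κ, and let F be a strictly κ-generated model of T. Then F has a generating set U of cardinality κ together with a linear order ≤ on U making ⟨U,≤⟩ a dense linear order without endpoints, such that U is a set of order-indiscernibles in F with respect to all L-formulas: for every n, every L-formula φ(x₁,…,xₙ), and any two strictly <-increasing n-tuples ā, b̄ from U, F ⊨ φ(ā) ↔ φ(b̄). -/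
open FirstOrder Language Cardinal

universe u

namespace Indiscernible

open Filter

/-- The iterated ultrafilter quantifier: `iter D n Q` says that for `D`-most `x₁`, …, for `D`-most
`xₙ`, the list `[x₁, …, xₙ]` satisfies `Q`. -/
def iter {A : Type u} (D : Ultrafilter A) : ℕ → (List A → Prop) → Prop
  | 0, Q => Q []
  | n + 1, Q => ∀ᶠ x in D, iter D n fun l => Q (x :: l)

/-- The product of copies of `D` along a list of coordinates, the earlier ones being quantified
first; all the other coordinates are equal to `d`. -/
noncomputable def along {A I : Type u} (D : Ultrafilter A) (d : A) : List I → Ultrafilter (I → A)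
  | [] => pure fun _ => d
  | i :: l => D.bind fun x =>
      (along D d l).map fun f => open scoped Classical in Function.update f i x

lemma eventually_along_iff {A I : Type u} (D : Ultrafilter A) (d : A) {m l : List I}
    (hml : m.Sublist l) (hl : l.Nodup) (Q : List A → Prop) :
    (∀ᶠ f in along D d l, Q (m.map f)) ↔ iter D m.length Q := by
  classical
  have key (i : I) (l : List I) (P : (I → A) → Prop) :
      (∀ᶠ f in along D d (i :: l), P f) ↔
        ∀ᶠ x in D, ∀ᶠ f in along D d l, P (Function.update f i x) := Iff.rfl
  have upd (f : I → A) (i : I) (x : A) (m : List I) (hi : i ∉ m) :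
      m.map (Function.update f i x) = m.map f :=
    List.map_congr_left fun j hj => Function.update_of_ne (by rintro rfl; exact hi hj) _ _
  induction hml generalizing Q with
  | slnil => exact Iff.rfl
  | @cons m l i hml ih =>
    rw [List.nodup_cons] at hl
    have hi : i ∉ m := fun h => hl.1 (hml.subset h)
    simp only [key, upd _ _ _ _ hi, ih hl.2, eventually_const]
  | @cons_cons m l i hml ih =>
    rw [List.nodup_cons] at hl
    have hi : i ∉ m := fun h => hl.1 (hml.subset h)
    simp only [key, List.map_cons, upd _ _ _ _ hi, Function.update_self, List.length_cons, iter]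
    exact eventually_congr (Eventually.of_forall fun x => ih hl.2 fun l => Q (x :: l))

/-- The limit of the ultrafilters `along D d s` over the finite sets `s` of coordinates. -/
noncomputable def limit {A I : Type u} [LinearOrder I] (D : Ultrafilter A) (d : A) :
    Ultrafilter (I → A) :=
  (Ultrafilter.of (atTop : Filter (Finset I))).bind fun s => along D d s.sort

lemma eventually_limit_iff {A I : Type u} [LinearOrder I] (D : Ultrafilter A) (d : A)
    {m : List I} (hm : m.SortedLT) (Q : List A → Prop) :
    (∀ᶠ f in limit (I := I) D d, Q (m.map f)) ↔ iter D m.length Q := by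
  have h1 : (∀ᶠ f in limit (I := I) D d, Q (m.map f)) ↔
      ∀ᶠ s : Finset I in (Ultrafilter.of (atTop : Filter (Finset I)) : Filter (Finset I)),
        ∀ᶠ f in along D d s.sort, Q (m.map f) := Iff.rfl
  have h2 : ∀ᶠ s : Finset I in (Ultrafilter.of (atTop : Filter (Finset I)) : Filter (Finset I)),
      ((∀ᶠ f in along D d s.sort, Q (m.map f)) ↔ iter D m.length Q) := by
    refine Ultrafilter.of_le _ ((eventually_ge_atTop m.toFinset).mono fun s hs => ?_)
    refine eventually_along_iff D d ?_ (s.sortedLT_sort).nodup Q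
    refine List.sublist_of_subperm_of_sortedLE (List.subperm_of_subset hm.nodup ?_) hm.sortedLE
      s.sortedLT_sort.sortedLE
    intro i hi
    simpa using hs (by simpa using hi)
  rw [h1, eventually_congr h2, eventually_const]

lemma exists_sortedLT_map {I β : Type u} [LinearOrder I] [Finite β] (a : β → I)
    (ha : Function.Injective a) : ∃ m : List β, (∀ i, i ∈ m) ∧ (m.map a).SortedLT := by
  have := Fintype.ofFinite β
  let : LinearOrder β := LinearOrder.lift' a ha
  refine ⟨Finset.univ.sort, by simp, ?_⟩
  have h := (Finset.univ : Finset β).sortedLT_sort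
  rw [List.sortedLT_iff_pairwise] at h ⊢
  exact List.pairwise_map.2 h

variable {L : FirstOrder.Language.{u, u}}

lemma exists_indiscernible (F : Type u) [L.Structure F] [Infinite F] (I : Type u)
    [LinearOrder I] :
    ∃ (M : Type u) (_ : L.Structure M) (x : I → M), Function.Injective x ∧
      (∀ φ : L.Sentence, F ⊨ φ → M ⊨ φ) ∧
      ∀ (β : Type u) [Finite β] (a b : β → I), Function.Injective a →
        (∀ i j, a i < a j ↔ b i < b j) →
        ∀ φ : L.Formula β, φ.Realize (x ∘ a) ↔ φ.Realize (x ∘ b) := by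
  obtain ⟨d⟩ : Nonempty F := inferInstance
  let D : Ultrafilter F := hyperfilter F
  let E : Ultrafilter (I → F) := limit D d
  let x (i : I) : (E : Filter (I → F)).Product fun _ => F :=
    Quotient.mk ((E : Filter (I → F)).productSetoid fun _ => F) fun f => f i
  have hx (i j : I) : x i = x j ↔ ∀ᶠ f : I → F in E, f i = f j := Quotient.eq''
  have cast {β : Type u} (φ : L.Formula β) (a : β → I) :
      φ.Realize (x ∘ a) ↔ ∀ᶠ f : I → F in E, φ.Realize (f ∘ a) :=
    Ultraproduct.realize_formula_cast (u := E) (M := fun _ : I → F => F) φ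
      fun i (f : I → F) => f (a i)
  have inj {i j : I} (hij : i < j) : ∀ᶠ f : I → F in E, f i ≠ f j := by
    have := (eventually_limit_iff D d (m := [i, j]) (by simpa [List.sortedLT_iff_pairwise])
      fun l => l[0]? ≠ l[1]?).2
    simp only [List.map_cons, List.map_nil] at this
    refine (this ?_).mono fun f hf => by simpa using hf
    simp only [List.length_cons, List.length_nil, iter]
    refine Eventually.of_forall fun x => ?_
    have : ∀ᶠ y in D, y ≠ x := by
      have := (Set.finite_singleton x).compl_mem_hyperfilter
      exact this
    exact this.mono fun y hy => by simpa using hy.symm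
  refine ⟨(E : Filter (I → F)).Product fun _ => F, inferInstance, x,
    fun i j hij => ?_, fun φ hφ => ?_, fun β _ a b ha hab φ => ?_⟩
  · have hij' := (hx _ _).1 hij
    by_contra hne
    rcases lt_or_gt_of_ne hne with h | h
    · obtain ⟨f, h1, h2⟩ := (hij'.and (inj h)).exists
      exact h2 h1
    · obtain ⟨f, h1, h2⟩ := (hij'.and (inj h)).exists
      exact h2 h1.symm
  · exact (Ultraproduct.sentence_realize (u := E) (M := fun _ : I → F => F) φ).2
      (Eventually.of_forall fun _ => hφ)
  · obtain ⟨m, hm, hma⟩ := exists_sortedLT_map a ha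
    have hmb : (m.map b).SortedLT := by
      rw [List.sortedLT_iff_pairwise, List.pairwise_map] at hma ⊢
      exact hma.imp fun {i j} h => (hab i j).1 h
    let Q : List F → Prop := fun l => ∃ v : β → F, m.map v = l ∧ φ.Realize v
    have hQ (c : β → I) (f : I → F) : φ.Realize (f ∘ c) ↔ Q ((m.map c).map f) := by
      rw [List.map_map]
      refine ⟨fun h => ⟨_, rfl, h⟩, fun ⟨v, hv, h⟩ => ?_⟩
      convert h
      funext i
      exact (List.map_inj_left.1 hv i (hm i)).symm
    rw [cast, cast]
    simp only [hQ]
    rw [eventually_limit_iff D d hma, eventually_limit_iff D d hmb]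
    simp

end Indiscernible

lemma IsUniversalTheory.isUniversal {L : FirstOrder.Language.{u, u}} {T : L.Theory}
    (hT : IsUniversalTheory T) : T.IsUniversal := by
  refine ⟨fun φ hφ => ?_⟩
  obtain ⟨n, ψ, hψ, rfl⟩ := hT φ hφ
  have key : ∀ (n : ℕ) (ψ : L.BoundedFormula Empty n),
      ψ.IsUniversal → BoundedFormula.IsUniversal ψ.alls := by
    intro n
    induction n with
    | zero => exact fun ψ h => h
    | succ n ih => exact fun ψ h => ih _ h.all
  exact key n ψ hψ.isUniversal

namespace Indiscernible

variable {L : FirstOrder.Language.{u, u}}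

/-- Quantifier-free order-indiscernibility of a sequence indexed by a linear order, along finite
families of indices that need not be enumerated in increasing order. -/
def IsQFIndiscernible (L : FirstOrder.Language.{u, u}) {G I : Type u} [L.Structure G]
    [LinearOrder I] (y : I → G) : Prop :=
  ∀ (β : Type u) [Finite β] (a b : β → I), Function.Injective a →
    (∀ i j, a i < a j ↔ b i < b j) →
    ∀ φ : L.Formula β, φ.IsQF → (φ.Realize (y ∘ a) ↔ φ.Realize (y ∘ b))

lemma exists_generated_model {T : L.Theory} (hT : IsUniversalTheory T) (F : Type u)
    [L.Structure F] [Infinite F] (hF : F ⊨ T) (I : Type u) [LinearOrder I] :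
    ∃ (G : Type u) (_ : L.Structure G) (y : I → G), G ⊨ T ∧ Function.Injective y ∧
      Generates L G (Set.range y) ∧ IsQFIndiscernible L y := by
  obtain ⟨M, _, x, hx, hM, hind⟩ := exists_indiscernible (L := L) F I
  have := hT.isUniversal
  have : M ⊨ T := ⟨fun φ hφ => hM φ (hF.realize_of_mem φ hφ)⟩
  let S := Substructure.closure L (Set.range x)
  let y : I → S := fun i => ⟨x i, Substructure.subset_closure ⟨i, rfl⟩⟩
  refine ⟨S, inferInstance, y, inferInstance, fun i j h => hx (congrArg Subtype.val h), ?_, ?_⟩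
  · have h : S.subtype.toHom '' Set.range y = Set.range x := by
      rw [← Set.range_comp]; rfl
    rw [Generates, eq_top_iff]
    rintro ⟨g, hg⟩ -
    have hg' := hg
    simp only [S] at hg'
    rw [← h, Substructure.closure_image] at hg'
    obtain ⟨z, hz, hzg⟩ := hg'
    have : z = ⟨g, hg⟩ := Subtype.ext hzg
    exact this ▸ hz
  · intro β _ a b ha hab φ hφ
    have emb (c : β → I) : φ.Realize (y ∘ c) ↔ φ.Realize (x ∘ c) := by
      have := hφ.realize_embedding S.subtype (v := y ∘ c) (xs := default)
      rw [Formula.Realize, ← this, Formula.Realize]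
      exact iff_of_eq (congrArg _ (Subsingleton.elim _ _))
    rw [emb, emb]
    exact hind β a b ha hab φ

variable {G I : Type u} [L.Structure G] [LinearOrder I] {y : I → G}

lemma exists_term_of_mem_closure_image {s : Set I} {g : G}
    (hg : g ∈ Substructure.closure L (y '' s)) :
    ∃ t : L.Term I, (t.varFinset : Set I) ⊆ s ∧ t.realize y = g := by
  obtain ⟨t, rfl⟩ := Substructure.mem_closure_iff_exists_term.1 hg
  choose f hf hfy using fun z : y '' s => z.2
  refine ⟨t.relabel f, fun i hi => ?_, ?_⟩
  · induction t with
    | var z =>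
      simp only [Term.relabel, Term.varFinset, Finset.coe_singleton, Set.mem_singleton_iff] at hi
      exact hi ▸ hf z
    | func F ts ih =>
      simp only [Term.relabel, Term.varFinset, Finset.coe_biUnion, Set.mem_iUnion] at hi
      obtain ⟨k, -, hk⟩ := hi
      exact ih k (Substructure.mem_closure_iff_exists_term.2 ⟨_, rfl⟩) hk
  · rw [Term.realize_relabel]
    exact congrArg (fun v => t.realize v) (funext hfy)

lemma PartialIso.exists_extend_left [DenselyOrdered I] [NoMinOrder I] [NoMaxOrder I] [Nonempty I]
    (p : Order.PartialIso I I) (s : Finset I) :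
    ∃ q : Order.PartialIso I I, p.val ⊆ q.val ∧ ∀ i ∈ s, ∃ j, (i, j) ∈ q.val := by
  induction s using Finset.induction_on with
  | empty => exact ⟨p, subset_rfl, by simp⟩
  | insert i s _ ih =>
    obtain ⟨q, hpq, hq⟩ := ih
    obtain ⟨r, hr, hqr⟩ := (Order.PartialIso.definedAtLeft I i).isCofinal q
    refine ⟨r, hpq.trans hqr, fun k hk => ?_⟩
    rcases Finset.mem_insert.1 hk with rfl | hk
    · exact hr
    · exact (hq k hk).imp fun j hj => hqr hj

lemma PartialIso.exists_extend_right [DenselyOrdered I] [NoMinOrder I] [NoMaxOrder I] [Nonempty I]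
    (p : Order.PartialIso I I) (s : Finset I) :
    ∃ q : Order.PartialIso I I, p.val ⊆ q.val ∧ ∀ j ∈ s, ∃ i, (i, j) ∈ q.val := by
  induction s using Finset.induction_on with
  | empty => exact ⟨p, subset_rfl, by simp⟩
  | insert i s _ ih =>
    obtain ⟨q, hpq, hq⟩ := ih
    obtain ⟨r, hr, hqr⟩ := (Order.PartialIso.definedAtRight I i).isCofinal q
    refine ⟨r, hpq.trans hqr, fun k hk => ?_⟩
    rcases Finset.mem_insert.1 hk with rfl | hk
    · exact hr
    · exact (hq k hk).imp fun j hj => hqr hj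

lemma exists_term_of_generates (hy : Generates L G (Set.range y)) (g : G) :
    ∃ t : L.Term I, t.realize y = g := by
  have hg : g ∈ Substructure.closure L (y '' Set.univ) := by
    rw [Set.image_univ, show Substructure.closure L (Set.range y) = ⊤ from hy]
    trivial
  exact (exists_term_of_mem_closure_image hg).imp fun t ht => ht.2

/-- The values of a term at the left-hand sides of the pairs of a finite partial isomorphism. -/
abbrev leftVal (y : I → G) (p : Order.PartialIso I I) (t : L.Term p.val) : G :=
  t.realize fun z => y z.1.1

/-- The values of a term at the right-hand sides of the pairs of a finite partial isomorphism. -/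
abbrev rightVal (y : I → G) (p : Order.PartialIso I I) (t : L.Term p.val) : G :=
  t.realize fun z => y z.1.2

lemma IsQFIndiscernible.realize_iff_partialIso (h : IsQFIndiscernible L y)
    (p : Order.PartialIso I I) (φ : L.Formula p.val) (hφ : φ.IsQF) :
    (φ.Realize fun z => y z.1.1) ↔ φ.Realize fun z => y z.1.2 := by
  refine h p.val (fun z => z.1.1) (fun z => z.1.2) (fun z w hzw => ?_) (fun z w => ?_) φ hφ
  · have := p.prop z.1 z.2 w.1 w.2
    rw [cmp_eq_eq_iff _ _ |>.2 hzw, eq_comm, cmp_eq_eq_iff] at this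
    exact Subtype.ext (Prod.ext hzw this)
  · exact lt_iff_lt_of_cmp_eq_cmp (p.prop z.1 z.2 w.1 w.2)

/-- Back and forth: a quantifier-free indiscernible generating sequence indexed by a dense linear
order without endpoints is indiscernible for all formulas. -/
lemma IsQFIndiscernible.realize_iff [DenselyOrdered I] [NoMinOrder I] [NoMaxOrder I] [Nonempty I]
    (h : IsQFIndiscernible L y) (hy : Generates L G (Set.range y)) {β : Type*} {n : ℕ}
    (φ : L.BoundedFormula β n) (p : Order.PartialIso I I) (v : β → L.Term p.val)
    (xs : Fin n → L.Term p.val) :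
    φ.Realize (leftVal y p ∘ v) (leftVal y p ∘ xs) ↔
      φ.Realize (rightVal y p ∘ v) (rightVal y p ∘ xs) := by
  have subst {k : ℕ} (p : Order.PartialIso I I) (v : β → L.Term p.val)
      (xs : Fin k → L.Term p.val) (t : L.Term (β ⊕ Fin k)) (w : p.val → G) :
      t.realize (Sum.elim (fun i => (v i).realize w) fun i => (xs i).realize w) =
        (t.subst (Sum.elim v xs)).realize w := by
    rw [Term.realize_subst]
    congr 1
    funext i
    cases i <;> rfl
  induction φ generalizing p with
  | falsum => exact Iff.rfl
  | equal t₁ t₂ =>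
    simp only [BoundedFormula.Realize, Function.comp_def, leftVal, rightVal, subst]
    have := h.realize_iff_partialIso p
      (Term.equal (t₁.subst (Sum.elim v xs)) (t₂.subst (Sum.elim v xs)))
      (BoundedFormula.IsAtomic.equal _ _).isQF
    simpa only [Formula.realize_equal] using this
  | rel R ts =>
    simp only [BoundedFormula.Realize, Function.comp_def, leftVal, rightVal, subst]
    have := h.realize_iff_partialIso p
      (R.formula fun i => (ts i).subst (Sum.elim v xs))
      (BoundedFormula.IsAtomic.rel _ _).isQF
    simpa only [Formula.realize_rel] using this
  | imp _ _ ih₁ ih₂ =>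
    simp only [BoundedFormula.Realize, ih₁, ih₂]
  | @all k φ ih =>
    have ext {q : Order.PartialIso I I} (hpq : p.val ⊆ q.val) (t : L.Term q.val) :
        φ.Realize (leftVal y p ∘ v) (Fin.snoc (leftVal y p ∘ xs) (leftVal y q t)) ↔
          φ.Realize (rightVal y p ∘ v) (Fin.snoc (rightVal y p ∘ xs) (rightVal y q t)) := by
      have hl (s : L.Term p.val) :
          leftVal y q (s.relabel fun z => ⟨z.1, hpq z.2⟩) = leftVal y p s :=
        Term.realize_relabel
      have hr (s : L.Term p.val) :
          rightVal y q (s.relabel fun z => ⟨z.1, hpq z.2⟩) = rightVal y p s :=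
        Term.realize_relabel
      have := ih q (fun i => (v i).relabel fun z => ⟨z.1, hpq z.2⟩)
        (Fin.snoc (fun i => (xs i).relabel fun z => ⟨z.1, hpq z.2⟩) t)
      rw [Fin.comp_snoc, Fin.comp_snoc] at this
      simpa only [Function.comp_def, hl, hr] using this
    simp only [BoundedFormula.Realize]
    refine ⟨fun H g => ?_, fun H g => ?_⟩
    · obtain ⟨t, rfl⟩ := exists_term_of_generates hy g
      obtain ⟨q, hpq, hq⟩ := PartialIso.exists_extend_right p t.varFinset
      choose f hf using fun j : t.varFinset => hq j.1 j.2
      have ht : rightVal y q (t.restrictVar fun j => ⟨(f j, j.1), hf j⟩) = t.realize y :=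
        Term.realize_restrictVar y fun _ => rfl
      rw [← ht]
      exact (ext hpq _).1 (H _)
    · obtain ⟨t, rfl⟩ := exists_term_of_generates hy g
      obtain ⟨q, hpq, hq⟩ := PartialIso.exists_extend_left p t.varFinset
      choose f hf using fun j : t.varFinset => hq j.1 j.2
      have ht : leftVal y q (t.restrictVar fun j => ⟨(j.1, f j), hf j⟩) = t.realize y :=
        Term.realize_restrictVar y fun _ => rfl
      rw [← ht]
      exact (ext hpq _).2 (H _)

lemma IsQFIndiscernible.realize_formula_iff [DenselyOrdered I] [NoMinOrder I] [NoMaxOrder I]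
    [Nonempty I] (h : IsQFIndiscernible L y) (hy : Generates L G (Set.range y)) {n : ℕ}
    (ψ : L.Formula (Fin n)) {a b : Fin n → I} (ha : StrictMono a) (hb : StrictMono b) :
    ψ.Realize (y ∘ a) ↔ ψ.Realize (y ∘ b) := by
  let p : Order.PartialIso I I := ⟨Finset.univ.image fun k => (a k, b k), by
    simp only [Finset.mem_image, Finset.mem_univ, true_and]
    rintro _ ⟨i, rfl⟩ _ ⟨j, rfl⟩
    rw [ha.cmp_map_eq, hb.cmp_map_eq]⟩
  have := h.realize_iff hy ψ p
    (fun k => Term.var ⟨(a k, b k), Finset.mem_image_of_mem _ (Finset.mem_univ k)⟩) default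
  rw [Subsingleton.elim (leftVal y p ∘ default) default,
    Subsingleton.elim (rightVal y p ∘ default) default] at this
  exact this

lemma IsQFIndiscernible.notMem_closure [DenselyOrdered I] [NoMinOrder I] [NoMaxOrder I]
    (h : IsQFIndiscernible L y) (hy : Function.Injective y) {s : Set I} {i : I} (hi : i ∉ s) :
    y i ∉ Substructure.closure L (y '' s) := by
  intro hmem
  obtain ⟨t, hts, ht⟩ := exists_term_of_mem_closure_image hmem
  have : Nonempty I := ⟨i⟩
  have hit : i ∉ t.varFinset := fun H => hi (hts H)
  obtain ⟨j, hj₁, hj₂⟩ := Order.exists_between_finsets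
    (insert i (t.varFinset.filter (· < i))) (t.varFinset.filter (i < ·)) (by
      simp only [Finset.mem_insert, Finset.mem_filter]
      rintro x (rfl | hx) z hz
      · exact hz.2
      · exact hx.2.trans hz.2)
  have hij : i < j := hj₁ i (Finset.mem_insert_self _ _)
  have hlt (k : I) (hk : k ∈ t.varFinset) : (k < j ↔ k < i) ∧ (j < k ↔ i < k) := by
    have hki : k ≠ i := fun H => hit (H ▸ hk)
    rcases lt_or_gt_of_ne hki with H | H
    · have : k < j := H.trans hij
      simp [H, this, H.not_gt, this.not_gt]
    · have : j < k := hj₂ k (Finset.mem_filter.2 ⟨hk, H⟩)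
      simp [H, this, H.not_gt, this.not_gt]
  let a : Option t.varFinset → I := fun o => o.elim i (↑)
  let b : Option t.varFinset → I := fun o => o.elim j (↑)
  have ha : Function.Injective a := by
    rintro (_ | k) (_ | l) hkl
    · rfl
    · exact (hit (show i ∈ t.varFinset from (show i = l.1 from hkl) ▸ l.2)).elim
    · exact (hit (show i ∈ t.varFinset from (show k.1 = i from hkl) ▸ k.2)).elim
    · exact congrArg some (Subtype.ext hkl)
  have hab (k l) : a k < a l ↔ b k < b l := by
    rcases k with _ | k <;> rcases l with _ | l
    · simp [a, b]
    · exact (hlt l.1 l.2).2.symm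
    · exact (hlt k.1 k.2).1.symm
    · exact Iff.rfl
  have key := h _ a b ha hab (Term.equal (Term.var none) (t.restrictVar some))
    (BoundedFormula.IsAtomic.equal _ _).isQF
  have hta : (t.restrictVar some).realize (y ∘ a) = t.realize y :=
    Term.realize_restrictVar y fun _ => rfl
  have htb : (t.restrictVar some).realize (y ∘ b) = t.realize y :=
    Term.realize_restrictVar y fun _ => rfl
  rw [Formula.realize_equal, Formula.realize_equal, hta, htb, ht] at key
  exact hij.ne' (hy (key.1 rfl))

lemma IsQFIndiscernible.strictlyGenerated [DenselyOrdered I] [NoMinOrder I] [NoMaxOrder I]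
    (h : IsQFIndiscernible L y) (hinj : Function.Injective y)
    (hy : Generates L G (Set.range y)) (hI : ℵ₀ < #I) : StrictlyGenerated L G #I := by
  refine ⟨⟨Set.range y, mk_range_eq y hinj, hy⟩, ?_⟩
  rintro ν hν ⟨Y, rfl, hY⟩
  choose t ht using fun g : Y => exists_term_of_generates hy g.1
  let J : Set I := ⋃ g : Y, ((t g).varFinset : Set I)
  have hJ : #J < #I := by
    refine (mk_iUnion_le fun g : Y => ((t g).varFinset : Set I)).trans_lt ?_
    refine (mul_le_mul_right (ciSup_le' fun g => (mk_le_aleph0 : _ ≤ ℵ₀)) _).trans_lt ?_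
    exact mul_lt_of_lt hI.le hν hI
  obtain ⟨i, hi⟩ : ∃ i, i ∉ J := by
    by_contra! H
    rw [Set.eq_univ_of_forall H, mk_univ] at hJ
    exact hJ.false
  refine h.notMem_closure hinj hi ?_
  have hle : Substructure.closure L Y ≤ Substructure.closure L (y '' J) := by
    refine Substructure.closure_le.2 fun g hg => ?_
    have hJ (k : (t ⟨g, hg⟩).varFinset) : y k.1 ∈ y '' J :=
      Set.mem_image_of_mem y (Set.mem_iUnion.2 ⟨⟨g, hg⟩, k.2⟩)
    refine Substructure.mem_closure_iff_exists_term.2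
      ⟨(t ⟨g, hg⟩).restrictVar fun k => ⟨y k.1, hJ k⟩, ?_⟩
    refine Eq.trans ?_ (ht ⟨g, hg⟩)
    exact Term.realize_restrictVar y fun _ => rfl
  rw [show Substructure.closure L Y = ⊤ from hY] at hle
  exact hle trivial

lemma exists_denseLinearOrder (κ : Cardinal.{u}) (hκ : ℵ₀ ≤ κ) :
    ∃ (I : Type u) (_ : LinearOrder I), #I = κ ∧ DenselyOrdered I ∧ NoMinOrder I ∧
      NoMaxOrder I := by
  refine ⟨κ.ord.ToType ×ₗ ℚ, inferInstance, ?_, inferInstance, inferInstance, inferInstance⟩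
  change #(κ.ord.ToType × ℚ) = κ
  simp [mul_eq_left hκ hκ aleph0_ne_zero]

end Indiscernible

/-- If `T` is a universal theory that is `κ`-unique for some uncountable `κ` and `F` is a
strictly `κ`-generated model of `T`, then `F` has a generating set `U` of cardinality `κ`
carrying a dense linear order without endpoints such that `U` is a set of order-indiscernibles
in `F` with respect to all `L`-formulas. -/
theorem stmt15 {L : FirstOrder.Language.{u, u}} (T : L.Theory)
    (hTuniv : IsUniversalTheory T)
    (κ : Cardinal.{u}) (hκ : ℵ₀ < κ) (hTκ : KUnique T κ)
    (F : Type u) [L.Structure F] (hFT : F ⊨ T) (hFgen : StrictlyGenerated L F κ) :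
    ∃ (U : Set F) (slt : F → F → Prop),
      #U = κ ∧ Generates L F U ∧
      -- `slt` is a strict linear order on `U` …
      (∀ x ∈ U, ¬ slt x x) ∧
      (∀ x ∈ U, ∀ y ∈ U, ∀ z ∈ U, slt x y → slt y z → slt x z) ∧
      (∀ x ∈ U, ∀ y ∈ U, slt x y ∨ x = y ∨ slt y x) ∧
      -- … which is dense …
      (∀ x ∈ U, ∀ y ∈ U, slt x y → ∃ z ∈ U, slt x z ∧ slt z y) ∧
      -- … without endpoints, and nonempty:
      (∀ x ∈ U, ∃ y ∈ U, slt y x) ∧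
      (∀ x ∈ U, ∃ y ∈ U, slt x y) ∧
      U.Nonempty ∧
      -- `U` is a set of order-indiscernibles with respect to all `L`-formulas:
      (∀ (n : ℕ) (ψ : L.Formula (Fin n)) (a b : Fin n → F),
        (∀ i, a i ∈ U) → (∀ i, b i ∈ U) →
        (∀ i j : Fin n, i < j → slt (a i) (a j)) →
        (∀ i j : Fin n, i < j → slt (b i) (b j)) →
        (ψ.Realize a ↔ ψ.Realize b)) := by
  have : Infinite F := by
    by_contra hfin
    rw [not_infinite_iff_finite] at hfin
    exact hFgen.2 #F ((lt_aleph0_of_finite F).trans hκ)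
      ⟨Set.univ, mk_univ, Substructure.closure_univ⟩
  obtain ⟨I, _, hI, _, _, _⟩ := Indiscernible.exists_denseLinearOrder κ hκ.le
  have : Nonempty I := by
    rw [← mk_ne_zero_iff, hI]
    exact (aleph0_pos.trans hκ).ne'
  obtain ⟨G, _, y, hG, hinj, hy, hind⟩ :=
    Indiscernible.exists_generated_model hTuniv F hFT I
  have hgen := hind.strictlyGenerated hinj hy (hI ▸ hκ)
  rw [hI] at hgen
  obtain ⟨e⟩ := hTκ.2 G F inferInstance inferInstance hG hFT hgen hFgen
  have hz : Function.Injective (e ∘ y) := e.injective.comp hinj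
  refine ⟨Set.range (e ∘ y), fun u v => ∃ i j, i < j ∧ e (y i) = u ∧ e (y j) = v, ?_, ?_, ?_, ?_,
    ?_, ?_, ?_, ?_, Set.range_nonempty _, ?_⟩
  · rw [mk_range_eq _ hz, hI]
  · rw [Generates, Set.range_comp]
    have := Substructure.closure_image (L := L) (s := Set.range y) e.toHom
    rw [show Substructure.closure L (Set.range y) = ⊤ from hy] at this
    refine this.trans (eq_top_iff.2 fun u _ => ?_)
    exact ⟨e.symm u, trivial, e.apply_symm_apply u⟩
  · rintro _ ⟨i, rfl⟩ ⟨j, k, hjk, hj, hk⟩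
    exact hjk.ne (hz (hj.trans hk.symm))
  · rintro _ - _ - _ - ⟨i, j, hij, hi, hj⟩ ⟨k, l, hkl, hk, hl⟩
    obtain rfl := hz (hj.trans hk.symm)
    exact ⟨i, l, hij.trans hkl, hi, hl⟩
  · rintro _ ⟨i, rfl⟩ _ ⟨j, rfl⟩
    rcases lt_trichotomy i j with h | rfl | h
    · exact Or.inl ⟨i, j, h, rfl, rfl⟩
    · exact Or.inr (Or.inl rfl)
    · exact Or.inr (Or.inr ⟨j, i, h, rfl, rfl⟩)
  · rintro _ - _ - ⟨i, j, hij, hi, hj⟩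
    obtain ⟨k, hik, hkj⟩ := exists_between hij
    exact ⟨e (y k), ⟨k, rfl⟩, ⟨i, k, hik, hi, rfl⟩, ⟨k, j, hkj, rfl, hj⟩⟩
  · rintro _ ⟨i, rfl⟩
    obtain ⟨j, hj⟩ := exists_lt i
    exact ⟨e (y j), ⟨j, rfl⟩, j, i, hj, rfl, rfl⟩
  · rintro _ ⟨i, rfl⟩
    obtain ⟨j, hj⟩ := exists_gt i
    exact ⟨e (y j), ⟨j, rfl⟩, i, j, hj, rfl, rfl⟩
  · intro n ψ a b ha hb hamono hbmono
    have key (c : Fin n → F) (hc : ∀ i, c i ∈ Set.range (e ∘ y))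
        (hmono : ∀ i j, i < j → ∃ k l, k < l ∧ e (y k) = c i ∧ e (y l) = c j) :
        ∃ d : Fin n → I, StrictMono d ∧ c = e ∘ (y ∘ d) := by
      choose d hd using hc
      refine ⟨d, fun i j hij => ?_, funext fun i => (hd i).symm⟩
      obtain ⟨k, l, hkl, hk, hl⟩ := hmono i j hij
      obtain rfl := hz (hk.trans (hd i).symm)
      obtain rfl := hz (hl.trans (hd j).symm)
      exact hkl
    obtain ⟨a, ha', rfl⟩ := key a ha hamono
    obtain ⟨b, hb', rfl⟩ := key b hb hbmono
    rw [StrongHomClass.realize_formula, StrongHomClass.realize_formula]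
    exact hind.realize_formula_iff hy ψ ha' hb'
end
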